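/- arXiv:2601.20081 — 2 statements merged into one kernel-verified Lean document; each statement's English description precedes it below -/
import Mathlib

section
/- Absence of eigenvalues in the singular-coin region: Let t ∈ (−1,1) with t ≠ 0, λ₁ ∈ [(1−t²)/(1+t²), 1), λ₂ ∈ (0,1), Φ irrational, and suppose θ is Φ-irrational (i.e. 2θ + jΦ ∉ ℤ for every j ∈ ℤ). Then the quantum-walk operator W = W_{λ₁,λ₂,Φ,θ} has no eigenvalues: if z ∈ ℂ and ψ ∈ ℓ²(ℤ; ℂ²) satisfies Wψ = zψ, then ψ = 0. -/
open MeasureTheory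

noncomputable section

/-- `λ' = √(1 - λ²)`. -/
def sq1 (l : ℝ) : ℝ := Real.sqrt (1 - l ^ 2)

/-- The sampling function `f(x) = (1/k)(2 t λ₂ cos(2πx) + (t²−1) λ₂′)` with `k = −(1+t²)`. -/
def fS (t l x : ℝ) : ℝ :=
  (1 / (-(1 + t ^ 2))) * (2 * t * l * Real.cos (2 * Real.pi * x) + (t ^ 2 - 1) * sq1 l)

/-- The sampling function `g(x) = (1/k)(−t² λ₂ e^{2πix} + λ₂ e^{−2πix} + 2 t λ₂′)`. -/
def gS (t l x : ℝ) : ℂ :=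
  ((1 / (-(1 + t ^ 2)) : ℝ) : ℂ) *
    (-(((t ^ 2 * l : ℝ)) : ℂ) * Complex.exp (2 * Real.pi * x * Complex.I)
      + ((l : ℝ) : ℂ) * Complex.exp (-(2 * Real.pi * x) * Complex.I)
      + ((2 * t * sq1 l : ℝ) : ℂ))

/-- The Hilbert space `ℓ²(ℤ; ℂ²)`. -/
abbrev H2 := lp (fun _ : ℤ => EuclideanSpace ℂ (Fin 2)) 2

/-- The `+` component of `W ψ = S_{λ₁} Q ψ` at site `n`. -/
def wPlus (t l1 l2 Φ θ : ℝ) (ψ : ℤ → EuclideanSpace ℂ (Fin 2)) (n : ℤ) : ℂ :=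
  (l1 : ℂ) * ((fS t l2 (θ + ((n : ℝ) - 1) * Φ) : ℂ) * ψ (n - 1) 0
      - gS t l2 (θ + ((n : ℝ) - 1) * Φ) * ψ (n - 1) 1)
    - (sq1 l1 : ℂ) * ((starRingEnd ℂ) (gS t l2 (θ + (n : ℝ) * Φ)) * ψ n 0
      + (fS t l2 (θ + (n : ℝ) * Φ) : ℂ) * ψ n 1)

/-- The `−` component of `W ψ = S_{λ₁} Q ψ` at site `n`. -/
def wMinus (t l1 l2 Φ θ : ℝ) (ψ : ℤ → EuclideanSpace ℂ (Fin 2)) (n : ℤ) : ℂ :=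
  (l1 : ℂ) * ((starRingEnd ℂ) (gS t l2 (θ + ((n : ℝ) + 1) * Φ)) * ψ (n + 1) 0
      + (fS t l2 (θ + ((n : ℝ) + 1) * Φ) : ℂ) * ψ (n + 1) 1)
    + (sq1 l1 : ℂ) * ((fS t l2 (θ + (n : ℝ) * Φ) : ℂ) * ψ n 0
      - gS t l2 (θ + (n : ℝ) * Φ) * ψ n 1)

/-- `ψ` is a (generalized) eigenvector of `W_{λ₁,λ₂,Φ,θ}` with eigenvalue `z`. -/
def IsEigen (t l1 l2 Φ θ : ℝ) (z : ℂ) (ψ : ℤ → EuclideanSpace ℂ (Fin 2)) : Prop :=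
  ∀ n : ℤ, wPlus t l1 l2 Φ θ ψ n = z * ψ n 0 ∧ wMinus t l1 l2 Φ θ ψ n = z * ψ n 1

section

open AddCircle

/-- `f` is a square-integrable function on the circle with Fourier coefficients `s`. -/
def HasFourierCoeffs (f : UnitAddCircle → ℂ) (s : ℤ → ℂ) : Prop :=
  MemLp f 2 haarAddCircle ∧ ∀ n, fourierCoeff f n = s n

lemma haarAddCircle_one_eq_volume : (haarAddCircle : Measure UnitAddCircle) = volume := by
  simp [volume_eq_smul_haarAddCircle]

namespace HasFourierCoeffs

variable {f g : UnitAddCircle → ℂ} {s r : ℤ → ℂ}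

lemma integrable (hf : HasFourierCoeffs f s) : Integrable f haarAddCircle :=
  hf.1.integrable (by norm_num)

lemma add (hf : HasFourierCoeffs f s) (hg : HasFourierCoeffs g r) :
    HasFourierCoeffs (fun x => f x + g x) (fun n => s n + r n) := by
  refine ⟨hf.1.add hg.1, fun n => ?_⟩
  have := congrFun (fourierCoeff.add hf.integrable hg.integrable) n
  rw [Pi.add_apply, hf.2, hg.2] at this
  exact this

lemma const_mul (c : ℂ) (hf : HasFourierCoeffs f s) :
    HasFourierCoeffs (fun x => c * f x) (fun n => c * s n) :=
  ⟨hf.1.const_mul c, fun n => by rw [fourierCoeff.const_mul, hf.2]⟩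

lemma fourier_mul (k : ℤ) (hf : HasFourierCoeffs f s) :
    HasFourierCoeffs (fun x => fourier k x * f x) (fun n => s (n - k)) := by
  refine ⟨?_, fun n => ?_⟩
  · refine hf.1.of_le ((fourier k).continuous.aestronglyMeasurable.mul hf.1.1)
      (ae_of_all _ fun x => ?_)
    rw [norm_mul, fourier_apply, Circle.norm_coe, one_mul]
  · beta_reduce
    rw [← hf.2, fourierCoeff, fourierCoeff]
    refine integral_congr_ae (ae_of_all _ fun x => ?_)
    simp only [smul_eq_mul]
    rw [← mul_assoc, ← fourier_add]
    congr 3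
    ring

lemma comp_add_right (c : UnitAddCircle) (hf : HasFourierCoeffs f s) :
    HasFourierCoeffs (fun x => f (x + c)) (fun n => fourier n c * s n) := by
  refine ⟨hf.1.comp_measurePreserving (measurePreserving_add_right _ c), fun n => ?_⟩
  beta_reduce
  rw [← hf.2, fourierCoeff, fourierCoeff,
    ← integral_add_right_eq_self (fun x => fourier (-n) x • f x) c, ← integral_const_mul]
  refine integral_congr_ae (ae_of_all _ fun x => ?_)
  have h : fourier n c * fourier (-n) c = 1 := by
    rw [← fourier_add]; simp
  have h2 : fourier (-n) (x + c) = fourier (-n) x * fourier (-n) c := by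
    simp only [fourier_apply, smul_add, toCircle_add, Circle.coe_mul]
  simp only [smul_eq_mul, h2]
  linear_combination (-(fourier (-n) x * f (x + c))) * h

lemma ae_eq (hf : HasFourierCoeffs f s) (hg : HasFourierCoeffs g s) :
    f =ᵐ[haarAddCircle] g := by
  have key : hf.1.toLp f = hg.1.toLp g := by
    apply fourierBasis.repr.injective
    ext n
    rw [fourierBasis_repr, fourierBasis_repr, fourierCoeff_congr_ae hf.1.coeFn_toLp,
      fourierCoeff_congr_ae hg.1.coeFn_toLp, hf.2, hg.2]
  exact (MemLp.toLp_eq_toLp_iff _ _).1 key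

end HasFourierCoeffs

lemma exists_hasFourierCoeffs {s : ℤ → ℂ} (hs : Memℓp s 2) :
    ∃ f, StronglyMeasurable f ∧ HasFourierCoeffs f s := by
  let F : Lp ℂ 2 (haarAddCircle : Measure UnitAddCircle) := fourierBasis.repr.symm ⟨s, hs⟩
  refine ⟨F, Lp.stronglyMeasurable F, Lp.memLp F, fun n => ?_⟩
  rw [← fourierBasis_repr]
  simp [F]

/-- A twisted-invariant bounded function on the circle vanishes when the twist is not in the
point spectrum of the rotation. -/
lemma ae_eq_zero_of_comp_add_eq_mul {u : UnitAddCircle → ℂ} (hu : MemLp u 2 haarAddCircle)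
    (c : UnitAddCircle) (ω : ℂ) (hω : ∀ n : ℤ, fourier n c ≠ ω)
    (h : ∀ᵐ x ∂haarAddCircle, u (x + c) = ω * u x) : u =ᵐ[haarAddCircle] 0 := by
  have hF : HasFourierCoeffs u (fourierCoeff u) := ⟨hu, fun _ => rfl⟩
  have h0 : HasFourierCoeffs (fun _ => (0 : ℂ)) (fun _ => 0) := by
    simpa using hF.const_mul 0
  have h1 := fourierCoeff_congr_ae h
  have h2 : ∀ n, fourierCoeff u n = 0 := fun n => by
    have h3 := congrFun h1 n
    rw [(hF.comp_add_right c).2, fourierCoeff.const_mul] at h3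
    have h4 : (fourier n c - ω) * fourierCoeff u n = 0 := by linear_combination h3
    exact (mul_eq_zero.1 h4).resolve_left (sub_ne_zero.2 (hω n))
  exact HasFourierCoeffs.ae_eq ⟨hu, h2⟩ h0

lemma ergodic_haarAddCircle_add_right {Φ : ℝ} (hΦ : Irrational Φ) :
    Ergodic (fun x : UnitAddCircle => x + (Φ : UnitAddCircle)) haarAddCircle := by
  rw [haarAddCircle_one_eq_volume]
  exact ergodic_add_right.2
    (denseRange_zsmul_iff.1 (denseRange_zsmul_coe_iff.2 (by simpa using hΦ)))

lemma ae_fourier_add_fourier_neg_ne {α β : ℂ} (hα : α ≠ 0) :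
    ∀ᵐ x ∂(haarAddCircle : Measure UnitAddCircle),
      α * (fourier 1 x + fourier (-1) x) - β ≠ 0 := by
  set P : Polynomial ℂ := .C α * .X ^ 2 - .C β * .X + .C α with hP
  have hP0 : P ≠ 0 := fun h => hα (by
    have := congrArg (Polynomial.eval 0) h
    simpa [hP] using this)
  have hfin : {x : UnitAddCircle | fourier 1 x ∈ {w : ℂ | P.IsRoot w}}.Finite := by
    refine (Polynomial.finite_setOfPred_isRoot hP0).preimage ?_
    intro x _ y _ hxy
    simp only [fourier_one] at hxy
    exact injective_toCircle one_ne_zero (Subtype.ext hxy)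
  rw [haarAddCircle_one_eq_volume]
  have : NullSingletonClass (volume : Measure UnitAddCircle) := ⟨fun x => by
    rw [← Metric.closedBall_zero, AddCircle.volume_closedBall]
    simp⟩
  filter_upwards [hfin.countable.ae_notMem volume] with x hx h0
  apply hx
  have h1 : fourier 1 x * fourier (-1) x = 1 := by rw [← fourier_add]; simp
  simp only [Polynomial.IsRoot, hP, Polynomial.eval_add, Polynomial.eval_sub,
    Polynomial.eval_mul, Polynomial.eval_C, Polynomial.eval_X, Polynomial.eval_pow]
  linear_combination fourier 1 x * h0 - α * h1

lemma fourier_one_add_fourier_neg_one (y : ℝ) :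
    fourier 1 (y : UnitAddCircle) + fourier (-1) (y : UnitAddCircle)
      = ((2 * Real.cos (2 * Real.pi * y) : ℝ) : ℂ) := by
  rw [fourier_coe_apply, fourier_coe_apply]
  push_cast
  rw [Complex.two_cos]
  congr 2 <;> ring

/-- The reciprocal of a real trigonometric polynomial `2α cos(2πx) - β` with a zero on the circle is
not integrable. -/
lemma eq_zero_of_mul_trig_ae_eq_const {G : UnitAddCircle → ℂ} (hG : Integrable G haarAddCircle)
    {α β : ℝ} {K : ℂ} (hα : α ≠ 0) (hβ : |β| ≤ |2 * α|)
    (h : ∀ᵐ x ∂(haarAddCircle : Measure UnitAddCircle),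
      ((α : ℂ) * (fourier 1 x + fourier (-1) x) - β) * G x = K) : K = 0 := by
  by_contra hK
  rw [haarAddCircle_one_eq_volume] at hG h
  have hmp := UnitAddCircle.measurePreserving_mk 0
  have hH : IntervalIntegrable (fun y : ℝ => G (y : UnitAddCircle)) volume 0 1 := by
    rw [intervalIntegrable_iff_integrableOn_Ioc_of_le zero_le_one]
    have := hmp.integrable_comp_of_integrable hG
    simpa [Function.comp_def, IntegrableOn] using this
  have hae : ∀ᵐ y : ℝ ∂(volume.restrict (Set.Ioc (0 : ℝ) 1)),
      ((α : ℂ) * (fourier 1 (y : UnitAddCircle) + fourier (-1) (y : UnitAddCircle)) - β)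
        * G (y : UnitAddCircle) = K := by
    have := hmp.quasiMeasurePreserving.ae h
    simpa using this
  set r : ℝ := β / (2 * α) with hr
  have h2α : 2 * α ≠ 0 := by positivity
  have hr1 : |r| ≤ 1 := by
    rw [hr, abs_div]
    exact div_le_one_of_le₀ hβ (abs_nonneg _)
  obtain ⟨hrl, hru⟩ := abs_le.1 hr1
  set c : ℝ := Real.arccos r / (2 * Real.pi) with hc
  have hpi := Real.pi_pos
  have hc2 : 2 * Real.pi * c = Real.arccos r := by rw [hc]; field_simp
  have hcos : Real.cos (2 * Real.pi * c) = r := by rw [hc2, Real.cos_arccos hrl hru]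
  have hc0 : 0 ≤ c := div_nonneg (Real.arccos_nonneg r) (by positivity)
  have hc1 : c ≤ 1 := by
    have := Real.arccos_le_pi r
    rw [hc, div_le_one (by positivity)]; linarith
  have hd : ∀ y : ℝ, ‖(α : ℂ) * (fourier 1 (y : UnitAddCircle) + fourier (-1) (y : UnitAddCircle))
      - β‖ ≤ |2 * α| * (2 * Real.pi) * |y - c| := fun y => by
    rw [fourier_one_add_fourier_neg_one, ← Complex.ofReal_mul, ← Complex.ofReal_sub,
      Complex.norm_real, Real.norm_eq_abs]
    have e : α * (2 * Real.cos (2 * Real.pi * y)) - β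
        = 2 * α * (Real.cos (2 * Real.pi * y) - Real.cos (2 * Real.pi * c)) := by
      rw [hcos, hr]; field_simp
    rw [e, abs_mul, mul_assoc |2 * α|]
    refine mul_le_mul_of_nonneg_left ?_ (abs_nonneg _)
    have := Real.abs_cos_sub_cos_le (2 * Real.pi * y) (2 * Real.pi * c)
    rwa [← mul_sub, abs_mul, abs_of_pos (by positivity : 0 < 2 * Real.pi)] at this
  have hint : IntervalIntegrable (fun y => (y - c)⁻¹) volume 0 1 := by
    refine (hH.const_mul ((|2 * α| * (2 * Real.pi) / ‖K‖ : ℝ) : ℂ)).mono_fun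
      (by fun_prop : Measurable fun y : ℝ => (y - c)⁻¹).aestronglyMeasurable ?_
    rw [Set.uIoc_of_le zero_le_one]
    filter_upwards [hae] with y hy
    rcases eq_or_ne y c with rfl | hyc
    · rw [sub_self, inv_zero, norm_zero]
      positivity
    have hyc' : 0 < |y - c| := abs_pos.2 (sub_ne_zero.2 hyc)
    have hK' : 0 < ‖K‖ := norm_pos_iff.2 hK
    have h3 : ‖K‖ ≤ |2 * α| * (2 * Real.pi) * |y - c| * ‖G (y : UnitAddCircle)‖ := by
      conv_lhs => rw [← hy, norm_mul]
      gcongr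
      exact hd y
    rw [norm_mul, norm_inv, Complex.norm_real, Real.norm_eq_abs, Real.norm_eq_abs,
      abs_of_nonneg (by positivity : 0 ≤ |2 * α| * (2 * Real.pi) / ‖K‖),
      inv_le_iff_one_le_mul₀ hyc', div_mul_eq_mul_div, div_mul_eq_mul_div, le_div_iff₀ hK']
    linarith
  rcases intervalIntegrable_sub_inv_iff.1 hint with h01 | hmem
  · exact zero_ne_one h01
  · exact hmem (by rw [Set.uIcc_of_le zero_le_one]; exact ⟨hc0, hc1⟩)

/-- Two proportional solutions of the dual walk have, along the rotation, proportionality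
factors that differ by the twist `w / w'`. -/
lemma dual_ratio_step {z w w' l l' d m m' a₀ b₀ p₀ q₀ a₁ q₁ ar br pr qr br₁ pr₁ h₀ h₁ : ℂ}
    (hz : z ≠ 0) (hl : l ≠ 0) (hd : d ≠ 0) (hw : w * w' = 1)
    (hp₀ : p₀ = -l * w * a₁ - l' * b₀) (hq₁ : q₁ = l' * a₁ - l * w' * b₀)
    (hqr : qr = l' * ar - l * w' * br₁) (hpr₁ : pr₁ = -l * w * ar - l' * br₁)
    (e₁ : z * a₀ = d * p₀ + m * q₀) (e₂ : z * b₀ = -m' * p₀ + d * q₀)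
    (e₃ : z * ar = d * pr + m' * qr) (e₄ : z * br = -m * pr + d * qr)
    (f₁ : br = h₀ * a₀) (f₂ : -pr = h₀ * q₀) (f₃ : br₁ = h₁ * a₁) (f₄ : -pr₁ = h₁ * q₁)
    (hne : ¬ (a₁ = 0 ∧ b₀ = 0)) : h₁ = w ^ 2 * h₀ := by
  have g₁ : qr = h₀ * p₀ := by
    apply mul_left_cancel₀ hd
    linear_combination -e₄ + z * f₁ - m * f₂ + h₀ * e₁
  have g₂ : ar = -h₀ * b₀ := by
    apply mul_left_cancel₀ hz
    linear_combination e₃ - d * f₂ + m' * g₁ + h₀ * e₂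
  have k₁ : b₀ * (w' * h₁ - w * h₀) = 0 := by
    apply mul_left_cancel₀ hl
    linear_combination f₄ + h₁ * hq₁ + hpr₁ - l' * f₃ - l * w * g₂
  have k₂ : a₁ * (w' * h₁ - w * h₀) = 0 := by
    apply mul_left_cancel₀ hl
    linear_combination hqr - g₁ - h₀ * hp₀ + l' * g₂ - l * w' * f₃
  have k : w' * h₁ - w * h₀ = 0 := by
    by_contra hk
    exact hne ⟨(mul_eq_zero.1 k₂).resolve_right hk, (mul_eq_zero.1 k₁).resolve_right hk⟩
  linear_combination w * k - h₁ * hw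

lemma proportional_of_det_eq_zero {a q A Q : ℂ} (hY : ¬ (a = 0 ∧ q = 0)) (hF : a * Q = A * q) :
    A = (A * (starRingEnd ℂ) a + Q * (starRingEnd ℂ) q)
        / (a * (starRingEnd ℂ) a + q * (starRingEnd ℂ) q) * a ∧
      Q = (A * (starRingEnd ℂ) a + Q * (starRingEnd ℂ) q)
        / (a * (starRingEnd ℂ) a + q * (starRingEnd ℂ) q) * q := by
  have hn : a * (starRingEnd ℂ) a + q * (starRingEnd ℂ) q ≠ 0 := by
    rw [Complex.mul_conj, Complex.mul_conj, ← Complex.ofReal_add, Complex.ofReal_ne_zero]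
    intro h
    have h₁ := Complex.normSq_nonneg a
    have h₂ := Complex.normSq_nonneg q
    exact hY ⟨Complex.normSq_eq_zero.1 (by linarith), Complex.normSq_eq_zero.1 (by linarith)⟩
  constructor
  · rw [div_mul_eq_mul_div, eq_div_iff hn]
    linear_combination -(starRingEnd ℂ) q * hF
  · rw [div_mul_eq_mul_div, eq_div_iff hn]
    linear_combination (starRingEnd ℂ) a * hF

/-- The dual walk with a singular coin has no nontrivial square-integrable eigenfunction. -/
lemma dual_walk_eigenfunction_eq_zero {Φ : ℝ} (hΦ : Irrational Φ) {a b p q m m' : UnitAddCircle → ℂ}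
    {z w w' l l' : ℂ} {α β : ℝ}
    (ha : StronglyMeasurable a) (hb : StronglyMeasurable b)
    (ha2 : MemLp a 2 haarAddCircle) (hb2 : MemLp b 2 haarAddCircle)
    (hl : l ≠ 0) (hll : l ^ 2 + l' ^ 2 = 1) (hw : w * w' = 1) (hwn : ‖w‖ = 1)
    (hω : ∀ n : ℤ, fourier n (Φ : UnitAddCircle) ≠ w ^ 2)
    (hα : α ≠ 0) (hβ : |β| ≤ |2 * α|)
    (hp : ∀ x, p x = -l * w * a (x + (Φ : UnitAddCircle)) - l' * b x)
    (hq : ∀ x, q x = l' * a x - l * w' * b (x + ((-Φ : ℝ) : UnitAddCircle)))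
    (hm : ∀ x, m (-x) = m' x)
    (hdm : ∀ x, ((α : ℂ) * (fourier 1 x + fourier (-1) x) - β) ^ 2 + m x * m' x = 1)
    (hs₁ : ∀ᵐ x ∂haarAddCircle,
      z * a x = ((α : ℂ) * (fourier 1 x + fourier (-1) x) - β) * p x + m x * q x)
    (hs₂ : ∀ᵐ x ∂haarAddCircle,
      z * b x = -m' x * p x + ((α : ℂ) * (fourier 1 x + fourier (-1) x) - β) * q x) :
    a =ᵐ[haarAddCircle] 0 ∧ b =ᵐ[haarAddCircle] 0 := by
  set c : UnitAddCircle := (Φ : UnitAddCircle) with hc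
  set d : UnitAddCircle → ℂ := fun x => (α : ℂ) * (fourier 1 x + fourier (-1) x) - β with hdd
  have hneg : ((-Φ : ℝ) : UnitAddCircle) = -c := by simp [hc]
  simp only [hneg] at hq
  have hd0 : ∀ᵐ x ∂(haarAddCircle : Measure UnitAddCircle), d x ≠ 0 :=
    ae_fourier_add_fourier_neg_ne (by exact_mod_cast hα)
  have hdneg : ∀ x, d (-x) = d x := fun x => by
    simp only [hdd, fourier_apply, neg_smul, one_smul, neg_neg]
    ring
  have hm' : ∀ x, m' (-x) = m x := fun x => by rw [← hm, neg_neg]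
  have mpN : MeasurePreserving (fun x : UnitAddCircle => -x) haarAddCircle haarAddCircle :=
    Measure.measurePreserving_neg _
  have mpS (v : UnitAddCircle) :
      MeasurePreserving (fun x : UnitAddCircle => x + v) haarAddCircle haarAddCircle :=
    measurePreserving_add_right _ v
  have aeN {P : UnitAddCircle → Prop} (h : ∀ᵐ x ∂haarAddCircle, P x) :
      ∀ᵐ x ∂haarAddCircle, P (-x) := mpN.quasiMeasurePreserving.ae h
  have aeS (v : UnitAddCircle) {P : UnitAddCircle → Prop} (h : ∀ᵐ x ∂haarAddCircle, P x) :
      ∀ᵐ x ∂haarAddCircle, P (x + v) := (mpS v).quasiMeasurePreserving.ae h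
  have hw0 : w ≠ 0 := left_ne_zero_of_mul_eq_one hw
  have hlw : -l * w ≠ 0 := mul_ne_zero (neg_ne_zero.2 hl) hw0
  have aeS' {f : UnitAddCircle → ℂ} (h : ∀ᵐ x ∂haarAddCircle, f (x + c) = 0) :
      f =ᵐ[haarAddCircle] 0 := by
    filter_upwards [aeS (-c) h] with x hx
    simpa using hx
  have hq₁ : ∀ x, q (x + c) = l' * a (x + c) - l * w' * b x := fun x => by
    rw [hq, add_neg_cancel_right]
  have hqr : ∀ x, q (-x) = l' * a (-x) - l * w' * b (-(x + c)) := fun x => by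
    rw [hq, neg_add]
  have hpr₁ : ∀ x, p (-(x + c)) = -l * w * a (-x) - l' * b (-(x + c)) := fun x => by
    rw [hp, neg_add, neg_add_cancel_right]
  by_cases hz : z = 0
  · have hpq : ∀ᵐ x ∂haarAddCircle, p x = 0 ∧ q x = 0 := by
      filter_upwards [hs₁, hs₂] with x h₁ h₂
      rw [hz, zero_mul] at h₁ h₂
      constructor
      · linear_combination (-d x) * h₁ + m x * h₂ - p x * hdm x
      · linear_combination (-m' x) * h₁ - d x * h₂ - q x * hdm x
    have hba : ∀ᵐ x ∂haarAddCircle, b x = 0 ∧ a (x + c) = 0 := by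
      filter_upwards [hpq, aeS c hpq] with x h h'
      have h₁ := h.1
      have h₂ := h'.2
      rw [hp] at h₁
      rw [hq₁] at h₂
      have hb0 : b x = 0 := by
        linear_combination (-l') * h₁ - l * w * h₂ - b x * hll - l ^ 2 * b x * hw
      rw [hb0, mul_zero, sub_zero] at h₁
      exact ⟨hb0, (mul_eq_zero.1 h₁).resolve_left hlw⟩
    exact ⟨aeS' (hba.mono fun x h => h.2), hba.mono fun x h => h.1⟩
  have site : ∀ᵐ x ∂haarAddCircle, z * a x = d x * p x + m x * q x ∧
      z * b x = -m' x * p x + d x * q x ∧ d x ≠ 0 := by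
    filter_upwards [hs₁, hs₂, hd0] with x h₁ h₂ h₃ using ⟨h₁, h₂, h₃⟩
  have siteN : ∀ᵐ x ∂haarAddCircle, z * a (-x) = d x * p (-x) + m' x * q (-x) ∧
      z * b (-x) = -m x * p (-x) + d x * q (-x) := by
    filter_upwards [aeN site] with x h
    rw [hdneg, hm, hm'] at h
    exact ⟨h.1, h.2.1⟩
  have hpm : Measurable p := by
    have := ha.measurable; have := hb.measurable
    rw [funext hp]; fun_prop
  have hqm : Measurable q := by
    have := ha.measurable; have := hb.measurable
    rw [funext hq]; fun_prop
  have ham := ha.measurable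
  have hbm := hb.measurable
  have hp2 : MemLp p 2 haarAddCircle := by
    rw [funext hp]
    exact ((ha2.comp_measurePreserving (mpS c)).const_mul _).sub (hb2.const_mul _)
  have hq2 : MemLp q 2 haarAddCircle := by
    rw [funext hq]
    exact (ha2.const_mul _).sub ((hb2.comp_measurePreserving (mpS (-c))).const_mul _)
  set F : UnitAddCircle → ℂ := fun x => -(a x * p (-x)) - b (-x) * q x with hF
  set G : UnitAddCircle → ℂ := fun x => -(p x * p (-x)) - q (-x) * q x with hG
  have hGint : Integrable G haarAddCircle :=
    (hp2.integrable_mul (hp2.comp_measurePreserving mpN)).neg.sub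
      ((hq2.comp_measurePreserving mpN).integrable_mul hq2)
  have hFG : ∀ᵐ x ∂haarAddCircle, z * F x = d x * G x ∧ F (x + c) = F x := by
    filter_upwards [site, siteN] with x h h'
    obtain ⟨h₁, h₂, h₃⟩ := h
    obtain ⟨h₄, h₅⟩ := h'
    have k₁ : z * F x = d x * G x := by
      simp only [hF, hG]
      linear_combination (-p (-x)) * h₁ - q x * h₅
    refine ⟨k₁, ?_⟩
    apply mul_left_cancel₀ hz
    rw [k₁]
    simp only [hF, hG, hq₁, hpr₁]
    have e₁ := hp x
    have e₂ := hqr x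
    linear_combination (-p x) * h₄ - q (-x) * h₂ + z * a (-x) * e₁ + z * b x * e₂
  obtain ⟨C, hC⟩ := (ergodic_haarAddCircle_add_right hΦ).ae_eq_const_of_ae_eq_comp_ae
    (g := F) (by fun_prop : Measurable F).aestronglyMeasurable (hFG.mono fun x h => h.2)
  have hC0 : z * C = 0 := by
    refine eq_zero_of_mul_trig_ae_eq_const hGint hα hβ ?_
    filter_upwards [hFG, hC] with x h h'
    rw [← h.1, h']
    rfl
  have hF0 : ∀ᵐ x ∂haarAddCircle, a x * -p (-x) = b (-x) * q x := by
    filter_upwards [hC] with x h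
    have : F x = 0 := h.trans ((mul_eq_zero.1 hC0).resolve_left hz)
    simp only [hF] at this
    linear_combination this
  set H : UnitAddCircle → ℂ := fun x =>
    (b (-x) * (starRingEnd ℂ) (a x) + -p (-x) * (starRingEnd ℂ) (q x))
      / (a x * (starRingEnd ℂ) (a x) + q x * (starRingEnd ℂ) (q x)) with hH
  have hHm : Measurable H := by fun_prop
  have hH0 : ∀ᵐ x ∂haarAddCircle, ¬ (a x = 0 ∧ q x = 0) →
      b (-x) = H x * a x ∧ -p (-x) = H x * q x :=
    hF0.mono fun x h hY => proportional_of_det_eq_zero hY h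
  have hZ : ∀ᵐ x ∂haarAddCircle, (a (x + c) = 0 ∧ q (x + c) = 0 ↔ a x = 0 ∧ q x = 0) ∧
      (a (x + c) = 0 ∧ b x = 0 → a x = 0 ∧ q x = 0) := by
    filter_upwards [site] with x h
    obtain ⟨h₁, h₂, h₃⟩ := h
    have key : a (x + c) = 0 ∧ b x = 0 → a x = 0 ∧ q x = 0 := by
      rintro ⟨k₁, k₂⟩
      have hp0 : p x = 0 := by rw [hp, k₁, k₂]; ring
      have hq0 : q x = 0 := by
        rw [k₂, hp0, mul_zero, mul_zero, zero_add] at h₂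
        exact (mul_eq_zero.1 h₂.symm).resolve_left h₃
      rw [hp0, hq0, mul_zero, mul_zero, zero_add] at h₁
      exact ⟨(mul_eq_zero.1 h₁).resolve_left hz, hq0⟩
    refine ⟨⟨?_, ?_⟩, key⟩
    · rintro ⟨k₁, k₂⟩
      refine key ⟨k₁, ?_⟩
      rw [hq₁, k₁, mul_zero, zero_sub, neg_eq_zero] at k₂
      exact (mul_eq_zero.1 k₂).resolve_left (mul_ne_zero hl (right_ne_zero_of_mul_eq_one hw))
    · rintro ⟨k₁, k₂⟩
      rw [k₁, k₂, mul_zero, mul_zero, add_zero] at h₁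
      have hp0 : p x = 0 := (mul_eq_zero.1 h₁.symm).resolve_left h₃
      rw [hp0, k₂, mul_zero, mul_zero, zero_add] at h₂
      have hb0 : b x = 0 := (mul_eq_zero.1 h₂).resolve_left hz
      rw [hp, hb0, mul_zero, sub_zero] at hp0
      have ha0 := (mul_eq_zero.1 hp0).resolve_left hlw
      exact ⟨ha0, by rw [hq₁, ha0, hb0]; ring⟩
  have hHinv : ∀ᵐ x ∂haarAddCircle, H (x + c) = w ^ 2 * H x := by
    filter_upwards [site, siteN, hH0, aeS c hH0, hZ] with x h h' k₀ k₁ kZ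
    by_cases hY : a x = 0 ∧ q x = 0
    · obtain ⟨y₁, y₂⟩ := kZ.1.2 hY
      simp [hH, y₁, y₂, hY.1, hY.2]
    · obtain ⟨f₁, f₂⟩ := k₀ hY
      obtain ⟨f₃, f₄⟩ := k₁ (fun hh => hY (kZ.1.1 hh))
      exact dual_ratio_step hz hl h.2.2 hw (hp x) (hq₁ x) (hqr x) (hpr₁ x) h.1 h.2.1 h'.1 h'.2
        f₁ f₂ f₃ f₄ (fun hh => hY (kZ.2 hh))
  have hu : (fun x => H x / ‖H x‖) =ᵐ[haarAddCircle] 0 := by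
    refine ae_eq_zero_of_comp_add_eq_mul (MemLp.of_bound (C := 1) ?_ ?_) c (w ^ 2) hω ?_
    · exact (by fun_prop : Measurable fun x => H x / ‖H x‖).aestronglyMeasurable
    · refine ae_of_all _ fun x => ?_
      rw [norm_div, Complex.norm_real, norm_norm]
      exact div_self_le_one _
    · filter_upwards [hHinv] with x hx
      rw [hx, norm_mul, norm_pow, hwn, one_pow, one_mul, mul_div_assoc]
  have hHz : ∀ᵐ x ∂haarAddCircle, H x = 0 := by
    filter_upwards [hu] with x hx
    simpa using hx
  have hYm : MeasurableSet {x | a x = 0 ∧ q x = 0} :=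
    (ham (measurableSet_singleton 0)).inter (hqm (measurableSet_singleton 0))
  rcases (ergodic_haarAddCircle_add_right hΦ).quasiErgodic.ae_mem_or_ae_notMem₀
    hYm.nullMeasurableSet (hZ.mono fun x h => propext h.1) with hall | hnone
  · refine ⟨hall.mono fun x h => h.1, ?_⟩
    filter_upwards [site, hall] with x h hY
    obtain ⟨h₁, h₂, h₃⟩ := h
    obtain ⟨k₁, k₂⟩ := hY
    rw [k₁, k₂, mul_zero, mul_zero, add_zero] at h₁
    rw [(mul_eq_zero.1 h₁.symm).resolve_left h₃, k₂, mul_zero, mul_zero, zero_add] at h₂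
    exact (mul_eq_zero.1 h₂).resolve_left hz
  · have hbp : ∀ᵐ x ∂haarAddCircle, b (-x) = 0 ∧ p (-x) = 0 := by
      filter_upwards [hH0, hHz, hnone] with x h h' hY
      obtain ⟨k₁, k₂⟩ := h hY
      rw [h', zero_mul] at k₁ k₂
      exact ⟨k₁, neg_eq_zero.1 k₂⟩
    have hbp' : ∀ᵐ x ∂haarAddCircle, b x = 0 ∧ p x = 0 := by
      filter_upwards [aeN hbp] with x hx
      simpa using hx
    refine ⟨aeS' (hbp'.mono fun x h => ?_), hbp'.mono fun x h => h.1⟩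
    have h₂ := h.2
    rw [hp, h.1, mul_zero, sub_zero] at h₂
    exact (mul_eq_zero.1 h₂).resolve_left hlw

end

lemma sq_add_sq1_sq {l : ℝ} (h₀ : 0 ≤ l) (h₁ : l < 1) : l ^ 2 + sq1 l ^ 2 = 1 := by
  rw [sq1, Real.sq_sqrt (by nlinarith)]
  ring

/-- The phase `e^{2πiθ}`. -/
def phase (θ : ℝ) : ℂ := Complex.exp (2 * Real.pi * θ * Complex.I)

lemma phase_add (θ η : ℝ) : phase (θ + η) = phase θ * phase η := by
  rw [phase, phase, phase, ← Complex.exp_add]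
  push_cast
  ring_nf

lemma phase_mul_phase_neg (θ : ℝ) : phase θ * phase (-θ) = 1 := by
  rw [← phase_add]
  simp [phase]

lemma norm_phase (θ : ℝ) : ‖phase θ‖ = 1 := by
  have : phase θ = Complex.exp ((2 * Real.pi * θ : ℝ) * Complex.I) := by
    rw [phase]; push_cast; rfl
  rw [this, Complex.norm_exp_ofReal_mul_I]

lemma fourier_coe_eq_phase (n : ℤ) (y : ℝ) : fourier n (y : UnitAddCircle) = phase (n * y) := by
  rw [fourier_coe_apply, phase]
  push_cast
  ring_nf

lemma fS_eq_phase (t l x : ℝ) :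
    (fS t l x : ℂ) = -(1 / (1 + (t : ℂ) ^ 2)) *
      (t * l * (phase x + phase (-x)) + ((t : ℂ) ^ 2 - 1) * sq1 l) := by
  have h : phase x + phase (-x) = 2 * Complex.cos (2 * Real.pi * x) := by
    rw [Complex.two_cos, phase, phase]
    push_cast
    ring_nf
  rw [h, fS]
  push_cast
  rw [div_neg]
  ring

lemma gS_eq_phase (t l x : ℝ) :
    gS t l x = -(1 / (1 + (t : ℂ) ^ 2)) *
      (-(t : ℂ) ^ 2 * l * phase x + l * phase (-x) + 2 * t * sq1 l) := by
  rw [gS, phase, phase]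
  push_cast
  rw [div_neg]
  ring_nf

lemma conj_phase (x : ℝ) : (starRingEnd ℂ) (phase x) = phase (-x) := by
  rw [phase, phase, ← Complex.exp_conj]
  simp [map_ofNat]

lemma conj_gS_eq_phase (t l x : ℝ) :
    (starRingEnd ℂ) (gS t l x) = -(1 / (1 + (t : ℂ) ^ 2)) *
      (-(t : ℂ) ^ 2 * l * phase (-x) + l * phase x + 2 * t * sq1 l) := by
  rw [gS_eq_phase]
  simp [conj_phase, map_ofNat]

lemma coin_plus_eq (t l x : ℝ) (y₀ y₁ : ℂ) :
    (fS t l x : ℂ) * y₀ - gS t l x * y₁ = 1 / (1 + (t : ℂ) ^ 2) *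
      (t * (-l * phase x * (y₀ + t * y₁) - sq1 l * (t * y₀ - y₁))
        + (sq1 l * (y₀ + t * y₁) - l * phase (-x) * (t * y₀ - y₁))) := by
  rw [fS_eq_phase, gS_eq_phase]
  ring

lemma coin_minus_eq (t l x : ℝ) (y₀ y₁ : ℂ) :
    (starRingEnd ℂ) (gS t l x) * y₀ + (fS t l x : ℂ) * y₁ = 1 / (1 + (t : ℂ) ^ 2) *
      ((-l * phase x * (y₀ + t * y₁) - sq1 l * (t * y₀ - y₁))
        - t * (sq1 l * (y₀ + t * y₁) - l * phase (-x) * (t * y₀ - y₁))) := by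
  rw [fS_eq_phase, conj_gS_eq_phase]
  ring

lemma memℓp_coord (ψ : H2) (i : Fin 2) : Memℓp (fun n => ψ n i) 2 := by
  have h := lp.memℓp ψ
  rw [memℓp_gen_iff (by norm_num)] at h ⊢
  refine h.of_nonneg_of_le (fun n => by positivity) fun n => ?_
  gcongr
  exact PiLp.norm_apply_le (ψ n) i

/-- Absence of eigenvalues in the singular-coin region: for `t ≠ 0`,
`λ₁ ∈ [(1−t²)/(1+t²), 1)`, `Φ` irrational and `θ` Φ-irrational, the walk operator
`W_{λ₁,λ₂,Φ,θ}` has no ℓ² eigenvectors. -/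
theorem no_eigenvalues_singular_region
    (t l1 l2 Φ θ : ℝ)
    (ht : t ∈ Set.Ioo (-1 : ℝ) 1) (ht0 : t ≠ 0)
    (hl1 : l1 ∈ Set.Ico ((1 - t ^ 2) / (1 + t ^ 2)) 1)
    (hl2 : l2 ∈ Set.Ioo (0 : ℝ) 1)
    (hΦ : Irrational Φ)
    (hθ : ∀ j m : ℤ, 2 * θ + (j : ℝ) * Φ ≠ (m : ℝ)) :
    ∀ (z : ℂ) (ψ : H2), IsEigen t l1 l2 Φ θ z (fun n => ψ n) → ψ = 0 := by
  intro z ψ hψ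
  have ht2 : t ^ 2 < 1 := by nlinarith [ht.1, ht.2]
  have h1t : 0 < 1 + t ^ 2 := by positivity
  have hl1pos : 0 < l1 := lt_of_lt_of_le (div_pos (by linarith) h1t) hl1.1
  have hr1 := sq_add_sq1_sq hl1pos.le hl1.2
  have hr2 := sq_add_sq1_sq hl2.1.le hl2.2
  have hr1c : (l1 : ℂ) ^ 2 + (sq1 l1 : ℂ) ^ 2 = 1 := by exact_mod_cast hr1
  have hr2c : (l2 : ℂ) ^ 2 + (sq1 l2 : ℂ) ^ 2 = 1 := by exact_mod_cast hr2
  have h1tc : 1 + (t : ℂ) ^ 2 ≠ 0 := by exact_mod_cast h1t.ne'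
  set α : ℝ := l1 * t / (1 + t ^ 2) with hα
  set β : ℝ := sq1 l1 * (1 - t ^ 2) / (1 + t ^ 2) with hβ
  have hα0 : α ≠ 0 := by positivity
  have hβα : |β| ≤ |2 * α| := by
    apply sq_le_sq.1
    have h := (div_le_iff₀ h1t).1 hl1.1
    have h2 : (1 - t ^ 2) ^ 2 ≤ l1 ^ 2 * (1 + t ^ 2) ^ 2 := by
      rw [← mul_pow]
      exact pow_le_pow_left₀ (by linarith) h 2
    rw [hα, hβ, ← mul_div_assoc, div_pow, div_pow]
    refine div_le_div_of_nonneg_right ?_ (sq_nonneg _)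
    linear_combination h2 + (1 - t ^ 2) ^ 2 * hr1
  have hαc : (α : ℂ) = l1 * t * (1 / (1 + (t : ℂ) ^ 2)) := by rw [hα]; push_cast; ring
  have hβc : (β : ℂ) = sq1 l1 * (1 - (t : ℂ) ^ 2) * (1 / (1 + (t : ℂ) ^ 2)) := by
    rw [hβ]; push_cast; ring
  set κ : ℂ := 1 / (1 + (t : ℂ) ^ 2) with hκ
  have hκt : κ * (1 + (t : ℂ) ^ 2) = 1 := one_div_mul_cancel h1tc
  set as : ℤ → ℂ := fun n => ψ n 0 + t * ψ n 1 with has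
  set bs : ℤ → ℂ := fun n => t * ψ n 0 - ψ n 1 with hbs
  obtain ⟨a, ham, hac⟩ := exists_hasFourierCoeffs (s := as)
    ((memℓp_coord ψ 0).add ((memℓp_coord ψ 1).const_mul (t : ℂ)))
  obtain ⟨b, hbm, hbc⟩ := exists_hasFourierCoeffs (s := bs)
    (((memℓp_coord ψ 0).const_mul (t : ℂ)).sub (memℓp_coord ψ 1))
  set w : ℂ := phase θ with hw
  set w' : ℂ := phase (-θ) with hw'
  set p : UnitAddCircle → ℂ := fun x => -l2 * w * a (x + (Φ : UnitAddCircle)) - sq1 l2 * b x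
    with hp
  set q : UnitAddCircle → ℂ :=
    fun x => sq1 l2 * a x - l2 * w' * b (x + ((-Φ : ℝ) : UnitAddCircle)) with hq
  set ps : ℤ → ℂ := fun n => -l2 * phase (θ + n * Φ) * as n - sq1 l2 * bs n with hps
  set qs : ℤ → ℂ := fun n => sq1 l2 * as n - l2 * phase (-(θ + n * Φ)) * bs n with hqs
  have hpc : HasFourierCoeffs p ps := by
    convert! ((hac.comp_add_right (Φ : UnitAddCircle)).const_mul (-l2 * w)).add
      (hbc.const_mul (-(sq1 l2 : ℂ))) using 1
    · funext x; simp only [hp]; ring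
    · funext n; simp only [hps, fourier_coe_eq_phase, phase_add]; ring
  have hqc : HasFourierCoeffs q qs := by
    convert! (hac.const_mul (sq1 l2 : ℂ)).add
      ((hbc.comp_add_right ((-Φ : ℝ) : UnitAddCircle)).const_mul (-l2 * w')) using 1
    · funext x; simp only [hq]; ring
    · funext n; simp only [hqs, fourier_coe_eq_phase, neg_add, phase_add, mul_neg]; ring
  have hu : ∀ n : ℤ, (fS t l2 (θ + n * Φ) : ℂ) * ψ n 0 - gS t l2 (θ + n * Φ) * ψ n 1
      = κ * (t * ps n + qs n) := fun n => coin_plus_eq t l2 _ _ _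
  have hv : ∀ n : ℤ, (starRingEnd ℂ) (gS t l2 (θ + n * Φ)) * ψ n 0
      + (fS t l2 (θ + n * Φ) : ℂ) * ψ n 1 = κ * (ps n - t * qs n) :=
    fun n => coin_minus_eq t l2 _ _ _
  have hplus : ∀ n : ℤ, z * ψ n 0 = l1 * (κ * (t * ps (n - 1) + qs (n - 1)))
      - sq1 l1 * (κ * (ps n - t * qs n)) := fun n => by
    rw [← (hψ n).1, ← hu, ← hv, wPlus]
    push_cast
    rfl
  have hminus : ∀ n : ℤ, z * ψ n 1 = l1 * (κ * (ps (n + 1) - t * qs (n + 1)))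
      + sq1 l1 * (κ * (t * ps n + qs n)) := fun n => by
    rw [← (hψ n).2, ← hu, ← hv, wMinus]
    push_cast
    rfl
  set m : UnitAddCircle → ℂ := fun x =>
    κ * (l1 * fourier 1 x - l1 * t ^ 2 * fourier (-1) x + 2 * t * sq1 l1) with hm
  set m' : UnitAddCircle → ℂ := fun x =>
    κ * (l1 * fourier (-1) x - l1 * t ^ 2 * fourier 1 x + 2 * t * sq1 l1) with hm'
  have hs₁ : ∀ᵐ x ∂AddCircle.haarAddCircle,
      z * a x = ((α : ℂ) * (fourier 1 x + fourier (-1) x) - β) * p x + m x * q x := by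
    have hL := hac.const_mul z
    have hR := ((((((hpc.fourier_mul 1).const_mul α).add ((hpc.fourier_mul (-1)).const_mul α)).add
      (hpc.const_mul (-β))).add ((hqc.fourier_mul 1).const_mul (κ * l1))).add
      ((hqc.fourier_mul (-1)).const_mul (-(κ * l1 * t ^ 2)))).add
      (hqc.const_mul (κ * (2 * t * sq1 l1)))
    have hs : (fun n => z * as n) = fun n =>
        l1 * t * κ * ps (n - 1) + l1 * t * κ * ps (n - -1)
          + -(sq1 l1 * (1 - (t : ℂ) ^ 2) * κ) * ps n + κ * l1 * qs (n - 1)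
          + -(κ * l1 * t ^ 2) * qs (n - -1) + κ * (2 * t * sq1 l1) * qs n := funext fun n => by
      have h₁ := hplus n
      have h₂ := hminus n
      rw [show n + 1 = n - -1 by ring] at h₂
      change z * (ψ n 0 + t * ψ n 1) = _
      linear_combination h₁ + t * h₂
    rw [hs] at hL
    rw [hαc, hβc] at hR ⊢
    filter_upwards [hL.ae_eq hR] with x hx
    rw [hx]
    simp only [hm]
    ring
  have hs₂ : ∀ᵐ x ∂AddCircle.haarAddCircle,
      z * b x = -m' x * p x + ((α : ℂ) * (fourier 1 x + fourier (-1) x) - β) * q x := by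
    have hL := hbc.const_mul z
    have hR := ((((((hqc.fourier_mul 1).const_mul α).add ((hqc.fourier_mul (-1)).const_mul α)).add
      (hqc.const_mul (-β))).add ((hpc.fourier_mul (-1)).const_mul (-(κ * l1)))).add
      ((hpc.fourier_mul 1).const_mul (κ * l1 * t ^ 2))).add
      (hpc.const_mul (-(κ * (2 * t * sq1 l1))))
    have hs : (fun n => z * bs n) = fun n =>
        l1 * t * κ * qs (n - 1) + l1 * t * κ * qs (n - -1)
          + -(sq1 l1 * (1 - (t : ℂ) ^ 2) * κ) * qs n + -(κ * l1) * ps (n - -1)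
          + κ * l1 * t ^ 2 * ps (n - 1) + -(κ * (2 * t * sq1 l1)) * ps n := funext fun n => by
      have h₁ := hplus n
      have h₂ := hminus n
      rw [show n + 1 = n - -1 by ring] at h₂
      change z * (t * ψ n 0 - ψ n 1) = _
      linear_combination t * h₁ - h₂
    rw [hs] at hL
    rw [hαc, hβc] at hR ⊢
    filter_upwards [hL.ae_eq hR] with x hx
    rw [hx]
    simp only [hm']
    ring
  have hω : ∀ n : ℤ, fourier n (Φ : UnitAddCircle) ≠ w ^ 2 := fun n hn => by
    rw [fourier_coe_eq_phase, hw, sq, ← phase_add, phase, phase, Complex.exp_eq_exp_iff_exists_int]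
      at hn
    obtain ⟨k, hk⟩ := hn
    apply hθ (-n) (-k)
    have h2 : (2 * Real.pi * Complex.I : ℂ) * ((n * Φ : ℝ) - (θ + θ : ℝ) - k) = 0 := by
      linear_combination hk
    have h3 := (mul_eq_zero.1 h2).resolve_left Complex.two_pi_I_ne_zero
    have h4 : n * Φ - (θ + θ) - k = 0 := by exact_mod_cast h3
    push_cast
    linarith
  have hdm : ∀ x, ((α : ℂ) * (fourier 1 x + fourier (-1) x) - β) ^ 2 + m x * m' x = 1 := fun x => by
    have h1 : fourier 1 x * fourier (-1) x = 1 := by rw [← fourier_add]; simp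
    simp only [hm, hm', hαc, hβc]
    linear_combination κ ^ 2 * l1 ^ 2 * (1 + (t : ℂ) ^ 2) ^ 2 * h1
      + κ ^ 2 * (1 + (t : ℂ) ^ 2) ^ 2 * hr1c + (κ * (1 + (t : ℂ) ^ 2) + 1) * hκt
  have hmneg : ∀ x, m (-x) = m' x := fun x => by
    simp only [hm, hm', fourier_apply, neg_smul, one_smul, neg_neg]
  obtain ⟨ha0, hb0⟩ := dual_walk_eigenfunction_eq_zero hΦ ham hbm hac.1 hbc.1
    (by exact_mod_cast hl2.1.ne') hr2c (phase_mul_phase_neg θ) (norm_phase θ) hω hα0 hβα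
    (fun _ => rfl) (fun _ => rfl) hmneg hdm hs₁ hs₂
  have has0 : ∀ n, as n = 0 := fun n => by
    rw [← hac.2, fourierCoeff_congr_ae ha0]; simp [fourierCoeff]
  have hbs0 : ∀ n, bs n = 0 := fun n => by
    rw [← hbc.2, fourierCoeff_congr_ae hb0]; simp [fourierCoeff]
  ext n i
  have h1 := has0 n
  have h2 := hbs0 n
  simp only [has, hbs] at h1 h2
  have hi : ψ n i = 0 := by
    apply mul_left_cancel₀ h1tc
    fin_cases i
    · simp only [Fin.zero_eta]
      linear_combination h1 + t * h2
    · simp only [Fin.mk_one]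
      linear_combination t * h1 - h2
  simpa using hi

end
end

section
/- Absence of eigenvalues in the critical (self-dual) region: Let t ∈ (−1,1), λ₁ = λ₂ ∈ (0, (1−t²)/(1+t²)), Φ irrational, and suppose θ is Φ-irrational (i.e. 2θ + jΦ ∉ ℤ for every j ∈ ℤ). Then the quantum-walk operator W = W_{λ₁,λ₁,Φ,θ} has no eigenvalues: if z ∈ ℂ and ψ ∈ ℓ²(ℤ; ℂ²) satisfies Wψ = zψ, then ψ = 0. -/
open MeasureTheory

noncomputable section

/-- Averages over the circle group are circle averages in the complex plane. -/
theorem integral_fourier_one_eq_circleAverage (h : ℂ → ℂ) :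
    ∫ x : UnitAddCircle, h (fourier 1 x) ∂AddCircle.haarAddCircle =
      Real.circleAverage h 0 1 := by
  rw [AddCircle.integral_haarAddCircle, ← UnitAddCircle.intervalIntegral_preimage 0,
    Real.circleAverage_def]
  have h1 : ∀ x : ℝ, h (fourier 1 ((x : ℝ) : UnitAddCircle)) = h (circleMap 0 1 (2 * Real.pi * x)) := by
    intro x
    rw [fourier_coe_apply, circleMap]
    congr 1
    push_cast
    simp
    congr 1
    ring
  simp_rw [h1]
  rw [intervalIntegral.integral_comp_mul_left (fun y => h (circleMap 0 1 y)) (by positivity)]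
  simp

theorem circleAverage_eq_of_differentiableOn_compl_zero {h : ℂ → ℂ}
    (hh : DifferentiableOn ℂ h {0}ᶜ) {ρ : ℝ} (hρ : 1 ≤ ρ) :
    Real.circleAverage h 0 1 = Real.circleAverage h 0 ρ := by
  rw [Real.circleAverage_eq_circleIntegral one_ne_zero,
    Real.circleAverage_eq_circleIntegral (by positivity)]
  congr 1
  refine (Complex.circleIntegral_sub_center_inv_smul_eq_of_differentiable_on_annulus_off_countable
    one_pos hρ Set.countable_empty ?_ ?_).symm
  · refine hh.continuousOn.mono ?_
    rintro z ⟨-, hz⟩ rfl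
    simp at hz
  · rintro z ⟨⟨-, hz⟩, -⟩
    refine hh.differentiableAt (isOpen_compl_singleton.mem_nhds ?_)
    rintro rfl
    simp at hz

theorem integral_fourier_neg_one_of_differentiable {y : ℂ → ℂ} (hy : Differentiable ℂ y) :
    ∫ x : UnitAddCircle, y (fourier (-1) x) ∂AddCircle.haarAddCircle = y 0 := by
  have h1 := integral_neg_eq_self (μ := (AddCircle.haarAddCircle (T := 1)))
    (fun x : UnitAddCircle => y (fourier 1 x))
  have h2 : ∀ x : UnitAddCircle, (fourier (-1) x : ℂ) = fourier 1 (-x) := by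
    intro x; simp [fourier_apply]
  simp_rw [h2, h1, integral_fourier_one_eq_circleAverage]
  exact DiffContOnCl.circleAverage (hy.diffContOnCl)

theorem prod_one_add_mul_pow_of_isPrimitiveRoot {n : ℕ} (hn : 0 < n) {ζ : ℂ}
    (hζ : IsPrimitiveRoot ζ n) (s : ℂ) :
    ∏ j ∈ Finset.range n, (1 + s * ζ ^ j) = 1 - (-s) ^ n := by
  have h := hζ.pow_sub_pow_eq_prod_sub_mul 1 (-s) hn
  rw [one_pow] at h
  rw [h]
  refine Finset.prod_bij (fun j _ => ζ ^ j) ?_ ?_ ?_ ?_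
  · intro j hj
    rw [Polynomial.mem_nthRootsFinset hn, ← pow_mul, mul_comm, pow_mul, hζ.pow_eq_one, one_pow]
  · intro i hi j hj hij
    exact hζ.pow_inj (Finset.mem_range.1 hi) (Finset.mem_range.1 hj) hij
  · intro ξ hξ
    rw [Polynomial.mem_nthRootsFinset hn] at hξ
    have : NeZero n := ⟨hn.ne'⟩
    obtain ⟨i, hi, rfl⟩ := hζ.eq_pow_of_pow_eq_one hξ
    exact ⟨i, Finset.mem_range.2 hi, rfl⟩
  · intro j hj
    ring

/-- Along the denominators of good rational approximations of `Φ`, the products of `1 + s w ^ j`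
with `w = exp (2πiΦ)` stay bounded. -/
theorem norm_prod_one_add_mul_exp_le {Φ : ℝ} {q : ℚ}
    (happ : |Φ - q| < 1 / (q.den : ℝ) ^ 2) {s : ℂ} {r : ℝ}
    (hs : ‖s‖ ≤ r) (hr : r < 1) :
    ‖∏ j ∈ Finset.range q.den, (1 + s * Complex.exp (2 * Real.pi * Complex.I * Φ) ^ j)‖ ≤
      2 * Real.exp (2 * Real.pi * r / (1 - r)) := by
  have hr0 : 0 ≤ r := (norm_nonneg s).trans hs
  obtain ⟨n, hn'⟩ : ∃ n, n = q.den := ⟨_, rfl⟩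
  have hn : 0 < n := hn' ▸ q.den_pos
  rw [← hn'] at happ ⊢
  have hnR : (0 : ℝ) < n := by exact_mod_cast hn
  set ζ : ℂ := Complex.exp (2 * Real.pi * Complex.I * q) with hζdef
  have hζ : IsPrimitiveRoot ζ n := hn' ▸ Complex.isPrimitiveRoot_exp_rat q
  have hζ1 : ‖ζ‖ = 1 := hζ.norm'_eq_one hn.ne'
  have hterm : ∀ j ∈ Finset.range n,
      ‖1 + s * Complex.exp (2 * Real.pi * Complex.I * Φ) ^ j‖ ≤
        ‖1 + s * ζ ^ j‖ * (1 + 2 * Real.pi * r / (1 - r) / n) := by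
    intro j hj
    have hjn : (j : ℝ) ≤ n := by exact_mod_cast (Finset.mem_range.1 hj).le
    have hd : ‖Complex.exp (2 * Real.pi * Complex.I * Φ) ^ j - ζ ^ j‖ ≤ 2 * Real.pi / n := by
      rw [hζdef, ← Complex.exp_nat_mul, ← Complex.exp_nat_mul]
      have : Complex.exp (j * (2 * Real.pi * Complex.I * Φ)) -
          Complex.exp (j * (2 * Real.pi * Complex.I * q)) =
          Complex.exp (j * (2 * Real.pi * Complex.I * q)) *
          (Complex.exp (Complex.I * ((j * (2 * Real.pi) * (Φ - q) : ℝ) : ℂ)) - 1) := by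
        rw [mul_sub, ← Complex.exp_add, mul_one]
        congr 2
        push_cast
        ring
      rw [this, norm_mul, Complex.exp_nat_mul, norm_pow, ← hζdef, hζ1, one_pow, one_mul]
      refine (Real.norm_exp_I_mul_ofReal_sub_one_le).trans ?_
      rw [Real.norm_eq_abs, abs_mul, abs_of_nonneg (by positivity)]
      calc (j : ℝ) * (2 * Real.pi) * |Φ - q| ≤ n * (2 * Real.pi) * (1 / (n : ℝ) ^ 2) := by
            gcongr
        _ = _ := by field_simp
    have hlow : 1 - r ≤ ‖1 + s * ζ ^ j‖ := by
      have h1 : ‖s * ζ ^ j‖ ≤ r := by simpa [hζ1] using hs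
      have h2 := norm_sub_norm_le (1 : ℂ) (-(s * ζ ^ j))
      rw [norm_neg, norm_one, sub_neg_eq_add] at h2
      linarith
    calc ‖1 + s * Complex.exp (2 * Real.pi * Complex.I * Φ) ^ j‖
        = ‖(1 + s * ζ ^ j) + s * (Complex.exp (2 * Real.pi * Complex.I * Φ) ^ j - ζ ^ j)‖ := by
          congr 1; ring
      _ ≤ ‖1 + s * ζ ^ j‖ + r * (2 * Real.pi / n) := by
          refine (norm_add_le _ _).trans ?_
          rw [norm_mul]
          gcongr
      _ = ‖1 + s * ζ ^ j‖ + (1 - r) * (2 * Real.pi * r / (1 - r) / n) := by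
          have : 1 - r ≠ 0 := by linarith
          field_simp
      _ ≤ ‖1 + s * ζ ^ j‖ + ‖1 + s * ζ ^ j‖ * (2 * Real.pi * r / (1 - r) / n) := by
          have : 0 < 1 - r := by linarith
          gcongr
      _ = _ := by ring
  have h1r : 0 < 1 - r := by linarith
  rw [norm_prod]
  refine (Finset.prod_le_prod (fun _ _ => norm_nonneg _) hterm).trans ?_
  rw [Finset.prod_mul_distrib, ← norm_prod, prod_one_add_mul_pow_of_isPrimitiveRoot hn hζ,
    Finset.prod_const, Finset.card_range]
  gcongr
  · refine (norm_sub_le _ _).trans ?_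
    rw [norm_one, norm_pow, norm_neg]
    have : ‖s‖ ^ n ≤ 1 := pow_le_one₀ (norm_nonneg _) (hs.trans hr.le)
    linarith
  · calc (1 + 2 * Real.pi * r / (1 - r) / n) ^ n
        ≤ (Real.exp (2 * Real.pi * r / (1 - r) / n)) ^ n := by
          gcongr
          rw [add_comm]
          exact Real.add_one_le_exp _
      _ = _ := by
          rw [← Real.exp_nat_mul]
          congr 1
          field_simp

theorem Irrational.exists_rat_abs_sub_lt_and_le_den {Φ : ℝ} (hΦ : Irrational Φ) (N : ℕ) :
    ∃ q : ℚ, |Φ - q| < 1 / (q.den : ℝ) ^ 2 ∧ N ≤ q.den := by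
  have h1 := hΦ.eventually_forall_le_dist_cast_rat_of_den_le N
  obtain ⟨ε, hε, h1⟩ := (Metric.eventually_nhds_iff.1 h1)
  obtain ⟨n, hn⟩ := exists_nat_one_div_lt (half_pos hε)
  obtain ⟨q, hq1, hq2⟩ := Real.exists_rat_abs_sub_le_and_den_le Φ (Nat.succ_pos n)
  have hd : (0 : ℝ) < q.den := by exact_mod_cast q.den_pos
  have hd1 : (1 : ℝ) ≤ q.den := by exact_mod_cast q.den_pos
  have hq2' : (q.den : ℝ) ≤ n + 1 := by exact_mod_cast hq2
  push_cast at hq1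
  refine ⟨q, lt_of_le_of_lt hq1 ?_, ?_⟩
  · rw [one_div_lt_one_div (by positivity) (by positivity)]
    nlinarith
  · by_contra! hlt
    have h2 := h1 (y := ε / 2) (by simp [abs_of_pos hε, hε]) q hlt.le
    rw [Real.dist_eq] at h2
    have : 1 / (((n : ℝ) + 1 + 1) * q.den) ≤ 1 / ((n : ℝ) + 1) := by
      apply one_div_le_one_div_of_le (by positivity)
      nlinarith
    linarith

theorem norm_circleAverage_le_of_norm_le {h : ℂ → ℂ} {R C : ℝ}
    (hC : ∀ ζ : ℂ, ‖ζ‖ = |R| → ‖h ζ‖ ≤ C) : ‖Real.circleAverage h 0 R‖ ≤ C := by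
  rw [Real.circleAverage_def, norm_smul]
  have h1 := intervalIntegral.norm_integral_le_of_norm_le_const
    (f := fun θ => h (circleMap 0 R θ)) (a := 0) (b := 2 * Real.pi) (C := C)
    (fun θ _ => hC _ (by simp))
  have hpi := Real.pi_pos
  rw [sub_zero, abs_of_pos (by positivity)] at h1
  rw [norm_inv, Real.norm_of_nonneg (by positivity), inv_mul_le_iff₀ (by positivity)]
  linarith

/-- The Laurent polynomial `∏ j < n, (1 + s w^j ζ) (1 + s (w^j ζ)⁻¹)`. -/
def birkhoffProd (s w : ℂ) (n : ℕ) (ζ : ℂ) : ℂ :=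
  ∏ j ∈ Finset.range n, ((1 + s * (w ^ j * ζ)) * (1 + s * (w ^ j * ζ)⁻¹))

theorem norm_birkhoffProd_le {Φ : ℝ} {q : ℚ} (happ : |Φ - q| < 1 / (q.den : ℝ) ^ 2) {s : ℂ}
    {ρ : ℝ} (hs : ‖s‖ * ρ < 1) {ζ : ℂ} (hζ1 : 1 ≤ ‖ζ‖) (hζρ : ‖ζ‖ ≤ ρ) :
    ‖birkhoffProd s (Complex.exp (2 * Real.pi * Complex.I * Φ)) q.den ζ‖ ≤
      (2 * Real.exp (2 * Real.pi * (‖s‖ * ρ) / (1 - ‖s‖ * ρ))) ^ 2 := by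
  have h1 := norm_prod_one_add_mul_exp_le happ (s := s * ζ) (r := ‖s‖ * ρ)
    (by rw [norm_mul]; gcongr) hs
  have h2 := norm_prod_one_add_mul_exp_le (Φ := -Φ) (q := -q)
    (by
      rw [Rat.cast_neg, ← neg_sub', abs_neg]
      simpa using happ)
    (s := s * ζ⁻¹) (r := ‖s‖ * ρ)
    (by
      rw [norm_mul, norm_inv]
      have : ‖ζ‖⁻¹ ≤ 1 := inv_le_one_of_one_le₀ hζ1
      gcongr
      linarith) hs
  rw [birkhoffProd, Finset.prod_mul_distrib, norm_mul, sq]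
  refine mul_le_mul (le_trans (le_of_eq ?_) h1) (le_trans (le_of_eq ?_) h2) (norm_nonneg _)
    (by positivity)
  · congr 1
    exact Finset.prod_congr rfl fun j _ => by ring
  · congr 1
    rw [Rat.den_neg_eq_den]
    refine Finset.prod_congr rfl fun j _ => ?_
    have : Complex.exp (2 * Real.pi * Complex.I * ((-Φ : ℝ) : ℂ)) =
        (Complex.exp (2 * Real.pi * Complex.I * Φ))⁻¹ := by
      rw [← Complex.exp_neg]
      congr 1
      push_cast
      ring
    rw [this, mul_inv, inv_pow]
    ring

theorem norm_integral_birkhoffProd_mul_fourier_le {Φ : ℝ} {q : ℚ}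
    (happ : |Φ - q| < 1 / (q.den : ℝ) ^ 2) {s : ℂ} {ρ : ℝ} (hρ : 1 ≤ ρ) (hs : ‖s‖ * ρ < 1)
    (m : ℤ) :
    ‖∫ x : UnitAddCircle, birkhoffProd s (Complex.exp (2 * Real.pi * Complex.I * Φ)) q.den
        (fourier 1 x) * fourier (-m) x ∂AddCircle.haarAddCircle‖ ≤
      (2 * Real.exp (2 * Real.pi * (‖s‖ * ρ) / (1 - ‖s‖ * ρ))) ^ 2 * ρ ^ (-m) := by
  have hρ0 : 0 < ρ := by linarith
  set w := Complex.exp (2 * Real.pi * Complex.I * Φ) with hw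
  have hw0 : w ≠ 0 := Complex.exp_ne_zero _
  have h1 : ∀ x : UnitAddCircle, (fourier (-m) x : ℂ) = (fourier 1 x) ^ (-m) := by
    intro x
    rw [fourier_apply, fourier_one, AddCircle.toCircle_zsmul, Circle.coe_zpow]
  simp_rw [h1]
  rw [integral_fourier_one_eq_circleAverage (fun ζ => birkhoffProd s w q.den ζ * ζ ^ (-m)),
    circleAverage_eq_of_differentiableOn_compl_zero _ hρ]
  · refine norm_circleAverage_le_of_norm_le fun ζ hζ => ?_
    rw [abs_of_pos hρ0] at hζ
    rw [norm_mul, norm_zpow, hζ]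
    gcongr
    exact norm_birkhoffProd_le happ hs (by rw [hζ]; exact hρ) hζ.le
  · intro ζ hζ
    have hζ0 : ζ ≠ 0 := hζ
    refine DifferentiableAt.differentiableWithinAt ?_
    refine DifferentiableAt.mul ?_ (differentiableAt_zpow.2 (Or.inl hζ0))
    unfold birkhoffProd
    refine DifferentiableAt.fun_finsetProd fun j _ => ?_
    have : w ^ j * ζ ≠ 0 := mul_ne_zero (pow_ne_zero _ hw0) hζ0
    fun_prop (disch := assumption)

theorem tendsto_zero_of_lipschitz_of_span_dense {E : Type*} [NormedAddCommGroup E]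
    [NormedSpace ℂ E] {φ : ℕ → E → ℂ} {C : ℝ} {S : Set E}
    (hadd : ∀ k x y, φ k (x + y) = φ k x + φ k y)
    (hsmul : ∀ (k : ℕ) (c : ℂ) (x : E), ‖φ k (c • x)‖ = ‖c‖ * ‖φ k x‖)
    (hbound : ∀ k x, ‖φ k x‖ ≤ C * ‖x‖)
    (hS : (Submodule.span ℂ S).topologicalClosure = ⊤)
    (h : ∀ x ∈ S, Filter.Tendsto (fun k => φ k x) Filter.atTop (nhds 0)) (x : E) :
    Filter.Tendsto (fun k => φ k x) Filter.atTop (nhds 0) := by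
  have hspan : ∀ y ∈ Submodule.span ℂ S,
      Filter.Tendsto (fun k => φ k y) Filter.atTop (nhds 0) := by
    intro y hy
    induction hy using Submodule.span_induction with
    | mem y hy => exact h y hy
    | zero =>
      have : ∀ k, φ k 0 = 0 := fun k => by simpa using hadd k 0 0
      simp [this]
    | add y z _ _ hy hz => simpa [hadd] using hy.add hz
    | smul c y _ hy =>
      rw [tendsto_zero_iff_norm_tendsto_zero] at hy ⊢
      simpa [hsmul] using hy.const_mul ‖c‖
  have hx : x ∈ closure (Submodule.span ℂ S : Set E) := by
    rw [← Submodule.topologicalClosure_coe, hS]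
    trivial
  rw [Metric.tendsto_atTop]
  intro ε hε
  have hC : 0 < |C| + 1 := by positivity
  obtain ⟨y, hy, hxy⟩ := Metric.mem_closure_iff.1 hx (ε / 2 / (|C| + 1)) (by positivity)
  obtain ⟨N, hN⟩ := Metric.tendsto_atTop.1 (hspan y hy) (ε / 2) (by positivity)
  refine ⟨N, fun k hk => ?_⟩
  have h1 := hN k hk
  rw [dist_zero_right] at h1 ⊢
  have h2 : φ k x = φ k (x - y) + φ k y := by rw [← hadd, sub_add_cancel]
  rw [dist_eq_norm] at hxy
  have h3 : C * ‖x - y‖ ≤ ε / 2 := by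
    calc C * ‖x - y‖ ≤ (|C| + 1) * ‖x - y‖ := by
          gcongr
          linarith [le_abs_self C]
      _ ≤ (|C| + 1) * (ε / 2 / (|C| + 1)) := by gcongr
      _ = ε / 2 := by field_simp
  calc ‖φ k x‖ ≤ ‖φ k (x - y)‖ + ‖φ k y‖ := h2 ▸ norm_add_le _ _
    _ < ε := by linarith [hbound k (x - y)]

theorem tendsto_inner_of_span_dense {E : Type*} [NormedAddCommGroup E]
    [InnerProductSpace ℂ E] {A : ℕ → E →L[ℂ] E} {C : ℝ} {S : Set E}
    (hbound : ∀ k x, ‖A k x‖ ≤ C * ‖x‖)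
    (hS : (Submodule.span ℂ S).topologicalClosure = ⊤)
    (h : ∀ x ∈ S, ∀ y ∈ S, Filter.Tendsto (fun k => inner ℂ y (A k x)) Filter.atTop (nhds 0))
    (x y : E) : Filter.Tendsto (fun k => inner ℂ y (A k x)) Filter.atTop (nhds 0) := by
  have h1 : ∀ x ∈ S, ∀ y,
      Filter.Tendsto (fun k => inner ℂ y (A k x)) Filter.atTop (nhds 0) := by
    intro x hx y
    refine tendsto_zero_of_lipschitz_of_span_dense (φ := fun k y => inner ℂ y (A k x))
      (C := C * ‖x‖) ?_ ?_ ?_ hS (h x hx) y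
    · intro k y z
      exact inner_add_left _ _ _
    · intro k c y
      simp [mul_comm]
    · intro k y
      calc ‖inner ℂ y (A k x)‖ ≤ ‖y‖ * ‖A k x‖ := norm_inner_le_norm _ _
        _ ≤ ‖y‖ * (C * ‖x‖) := by gcongr; exact hbound k x
        _ = _ := by ring
  refine tendsto_zero_of_lipschitz_of_span_dense (φ := fun k x => inner ℂ y (A k x))
      (C := C * ‖y‖) ?_ ?_ ?_ hS (fun x hx => h1 x hx y) x
  · intro k x z
    simp
  · intro k c x
    simp
  · intro k x
    calc ‖inner ℂ y (A k x)‖ ≤ ‖y‖ * ‖A k x‖ := norm_inner_le_norm _ _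
      _ ≤ ‖y‖ * (C * ‖x‖) := by gcongr; exact hbound k x
      _ = _ := by ring

theorem fourier_natCast_mul {n : ℕ} (m : ℤ) (Φ : ℝ) :
    (fourier m ((n • (Φ : UnitAddCircle) : UnitAddCircle)) : ℂ) = fourier m (Φ : UnitAddCircle) ^ n := by
  rw [fourier_apply, fourier_apply, smul_comm, AddCircle.toCircle_nsmul, Circle.coe_pow]

theorem fourier_add_apply (m : ℤ) (x y : UnitAddCircle) :
    (fourier m (x + y) : ℂ) = fourier m x * fourier m y := by
  rw [fourier_apply, smul_add, AddCircle.toCircle_add, Circle.coe_mul, fourier_apply, fourier_apply]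

theorem norm_fourier_apply (m : ℤ) (x : UnitAddCircle) : ‖(fourier m x : ℂ)‖ = 1 := by
  rw [fourier_apply, Circle.norm_coe]

theorem continuous_birkhoffProd_fourier {s w : ℂ} (hw : w ≠ 0) (n : ℕ) :
    Continuous fun x : UnitAddCircle => birkhoffProd s w n (fourier 1 x) := by
  unfold birkhoffProd
  refine continuous_finsetProd _ fun j _ => ?_
  have h0 : ∀ x : UnitAddCircle, w ^ j * (fourier 1 x : ℂ) ≠ 0 := fun x =>
    mul_ne_zero (pow_ne_zero _ hw) (norm_ne_zero_iff.1 (by rw [norm_fourier_apply]; exact one_ne_zero))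
  have h1 : Continuous fun x : UnitAddCircle => (fourier 1 x : ℂ) := (fourier 1).continuous
  fun_prop (disch := exact h0)

/-- Multiplication by `F` after translation by `a`, as an operator on `L²`. -/
def mulTranslate (F : C(UnitAddCircle, ℂ)) (a : UnitAddCircle) :
    Lp ℂ 2 (AddCircle.haarAddCircle (T := 1)) →L[ℂ] Lp ℂ 2 (AddCircle.haarAddCircle (T := 1)) :=
  ((ContinuousLinearMap.mul ℂ ℂ).holderL AddCircle.haarAddCircle ⊤ 2 2
    (ContinuousMap.toLp ⊤ AddCircle.haarAddCircle ℂ F)).comp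
    (Lp.compMeasurePreservingₗᵢ ℂ (· + a)
      (measurePreserving_add_right AddCircle.haarAddCircle a)).toContinuousLinearMap

theorem coeFn_mulTranslate (F : C(UnitAddCircle, ℂ)) (a : UnitAddCircle)
    (u : Lp ℂ 2 (AddCircle.haarAddCircle (T := 1))) :
    mulTranslate F a u =ᵐ[AddCircle.haarAddCircle] fun x => F x * u (x + a) := by
  have h1 := (ContinuousLinearMap.mul ℂ ℂ).coeFn_holder (r := 2)
    (ContinuousMap.toLp ⊤ AddCircle.haarAddCircle ℂ F)
    (Lp.compMeasurePreserving (· + a) (measurePreserving_add_right AddCircle.haarAddCircle a) u)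
  have h2 := Lp.coeFn_compMeasurePreserving u
    (measurePreserving_add_right AddCircle.haarAddCircle a)
  have h3 := ContinuousMap.coeFn_toLp (p := ⊤) AddCircle.haarAddCircle (𝕜 := ℂ) F
  filter_upwards [h1, h2, h3] with x h1 h2 h3
  refine h1.trans ?_
  rw [h2, h3]
  rfl

theorem norm_mulTranslate_le {F : C(UnitAddCircle, ℂ)} {C : ℝ}
    (hC : ∀ x, ‖F x‖ ≤ C) (a : UnitAddCircle) (u : Lp ℂ 2 (AddCircle.haarAddCircle (T := 1))) :
    ‖mulTranslate F a u‖ ≤ C * ‖u‖ := by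
  refine (Lp.norm_le_mul_norm_of_ae_le_mul (c := C) (g := Lp.compMeasurePreserving (· + a)
      (measurePreserving_add_right AddCircle.haarAddCircle a) u) ?_).trans (le_of_eq ?_)
  · filter_upwards [coeFn_mulTranslate F a u, Lp.coeFn_compMeasurePreserving u
      (measurePreserving_add_right AddCircle.haarAddCircle a)] with x h1 h2
    rw [h1, h2, norm_mul, Function.comp_apply]
    gcongr
    exact hC x
  · rw [Lp.norm_compMeasurePreserving]

theorem inner_toLp_mulTranslate (F : C(UnitAddCircle, ℂ)) (a : UnitAddCircle)
    {u v : UnitAddCircle → ℂ} (hu : MemLp u 2 AddCircle.haarAddCircle)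
    (hv : MemLp v 2 AddCircle.haarAddCircle) :
    inner ℂ (hv.toLp v) (mulTranslate F a (hu.toLp u)) =
      ∫ x, F x * u (x + a) * (starRingEnd ℂ) (v x) ∂AddCircle.haarAddCircle := by
  rw [L2.inner_def]
  refine integral_congr_ae ?_
  have h3 := (measurePreserving_add_right (AddCircle.haarAddCircle (T := 1)) a).quasiMeasurePreserving.ae_eq_comp
    hu.coeFn_toLp
  filter_upwards [coeFn_mulTranslate F a (hu.toLp u), hv.coeFn_toLp, h3] with x h1 h2 h3
  simp only [Function.comp_apply] at h3
  rw [h1, h2, h3]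
  simp [mul_comm]

theorem tendsto_integral_birkhoffProd {Φ : ℝ} {q : ℕ → ℚ}
    (happ : ∀ k, |Φ - q k| < 1 / ((q k).den : ℝ) ^ 2)
    (hq : Filter.Tendsto (fun k => (q k).den) Filter.atTop Filter.atTop)
    {s : ℂ} (hs : ‖s‖ < 1) {u v : UnitAddCircle → ℂ}
    (hu : MemLp u 2 AddCircle.haarAddCircle) (hv : MemLp v 2 AddCircle.haarAddCircle) :
    Filter.Tendsto (fun k => ∫ x : UnitAddCircle,
      birkhoffProd s (Complex.exp (2 * Real.pi * Complex.I * Φ)) (q k).den (fourier 1 x) *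
        fourier (-((q k).den : ℤ)) x * u (x + (q k).den • (Φ : UnitAddCircle)) *
        (starRingEnd ℂ) (v x) ∂AddCircle.haarAddCircle) Filter.atTop (nhds 0) := by
  set w := Complex.exp (2 * Real.pi * Complex.I * Φ) with hw
  obtain ⟨ρ, hρ1, hsρ⟩ : ∃ ρ : ℝ, 1 < ρ ∧ ‖s‖ * ρ < 1 := by
    have h0 := norm_nonneg s
    refine ⟨2 / (1 + ‖s‖), ?_, ?_⟩
    · rw [lt_div_iff₀ (by positivity)]
      linarith
    · rw [mul_div_assoc', div_lt_one (by positivity)]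
      linarith
  set C := (2 * Real.exp (2 * Real.pi * (‖s‖ * ρ) / (1 - ‖s‖ * ρ))) ^ 2 with hC
  let F : ℕ → C(UnitAddCircle, ℂ) := fun k =>
    ⟨fun x => birkhoffProd s w (q k).den (fourier 1 x) * fourier (-((q k).den : ℤ)) x,
      (continuous_birkhoffProd_fourier (Complex.exp_ne_zero _) _).mul (fourier _).continuous⟩
  have hF : ∀ k x, ‖F k x‖ ≤ C := by
    intro k x
    change ‖birkhoffProd s w (q k).den (fourier 1 x) * fourier (-((q k).den : ℤ)) x‖ ≤ C
    rw [norm_mul, norm_fourier_apply, mul_one]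
    exact norm_birkhoffProd_le (happ k) hsρ (norm_fourier_apply 1 x).ge
      ((norm_fourier_apply 1 x).le.trans hρ1.le)
  have key := tendsto_inner_of_span_dense
    (A := fun k => mulTranslate (F k) ((q k).den • (Φ : UnitAddCircle))) (C := C)
    (S := Set.range (fourierLp (T := 1) 2))
    (fun k x => norm_mulTranslate_le (hF k) _ x)
    (span_fourierLp_closure_eq_top (by norm_num)) ?_ (hu.toLp u) (hv.toLp v)
  · refine key.congr fun k => ?_
    rw [inner_toLp_mulTranslate]
    rfl
  · rintro _ ⟨i, rfl⟩ _ ⟨j, rfl⟩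
    have hmem : ∀ l : ℤ, MemLp (fourier (T := 1) l) 2 AddCircle.haarAddCircle := fun l =>
      (memLp_congr_ae (coeFn_fourierLp 2 l)).1 (Lp.memLp _)
    have hLp : ∀ l : ℤ, fourierLp (T := 1) 2 l = (hmem l).toLp _ := fun l =>
      Lp.ext ((coeFn_fourierLp 2 l).trans (hmem l).coeFn_toLp.symm)
    have hzero : Filter.Tendsto (fun k => C * (ρ ^ (i - j) * (ρ⁻¹) ^ (q k).den))
        Filter.atTop (nhds 0) := by
      have := (tendsto_pow_atTop_nhds_zero_of_lt_one (inv_nonneg.2 (by linarith))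
        (inv_lt_one_of_one_lt₀ hρ1)).comp hq
      simpa using (this.const_mul (ρ ^ (i - j))).const_mul C
    refine squeeze_zero_norm (fun k => ?_) hzero
    rw [hLp, hLp, inner_toLp_mulTranslate]
    have hcongr : ∀ x : UnitAddCircle,
        F k x * fourier i (x + (q k).den • (Φ : UnitAddCircle)) * (starRingEnd ℂ) (fourier j x) =
          (fourier i ((q k).den • (Φ : UnitAddCircle)) : ℂ) *
            (birkhoffProd s w (q k).den (fourier 1 x) *
              fourier (-(((q k).den : ℤ) - i + j)) x) := by
      intro x
      have h1 : (fourier (-(((q k).den : ℤ) - i + j)) x : ℂ) =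
          fourier (-((q k).den : ℤ)) x * fourier i x * (starRingEnd ℂ) (fourier j x) := by
        rw [← fourier_neg, ← fourier_add, ← fourier_add]
        congr 1
        congr 1
        ring
      rw [h1, fourier_add_apply]
      change birkhoffProd s w (q k).den (fourier 1 x) * fourier (-((q k).den : ℤ)) x * _ * _ = _
      ring
    simp_rw [hcongr]
    rw [integral_const_mul, norm_mul, norm_fourier_apply, one_mul]
    refine (norm_integral_birkhoffProd_mul_fourier_le (happ k) hρ1.le hsρ _).trans (le_of_eq ?_)
    rw [← hC, show -(((q k).den : ℤ) - i + j) = (i - j) + -((q k).den : ℤ) by ring,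
      zpow_add₀ (by linarith), zpow_neg, zpow_natCast, inv_pow]

/-- The upper right entry of the dual coin, as a Laurent polynomial in `ζ`. -/
def dualG (κ l l' t : ℝ) (ζ : ℂ) : ℂ := -κ * (l * ζ + 2 * t * l' - t ^ 2 * l * ζ⁻¹)

/-- The Laurent polynomial conjugate to `dualG`. -/
def dualGConj (κ l l' t : ℝ) (ζ : ℂ) : ℂ := κ * (t ^ 2 * l * ζ - 2 * t * l' - l * ζ⁻¹)

/-- The unnormalized transfer matrix of the dual walk, acting on pairs. -/
def dualStep (κ l l' t : ℝ) (z ζ : ℂ) (y : ℂ × ℂ) : ℂ × ℂ :=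
  ((z + l' * dualGConj κ l l' t ζ) * y.1 + (dualG κ l l' t ζ + l' * z⁻¹) * y.2,
    (l' * z + dualGConj κ l l' t ζ) * y.1 + (l' * dualG κ l l' t ζ + z⁻¹) * y.2)

/-- The orbit of `v` under the unnormalized dual cocycle over the rotation by `w`. -/
def dualOrbit (κ l l' t : ℝ) (z w : ℂ) (v : ℂ × ℂ) : ℕ → ℂ → ℂ × ℂ
  | 0, _ => v
  | n + 1, ζ => dualStep κ l l' t z (w ^ n * ζ) (dualOrbit κ l l' t z w v n ζ)

theorem dualG_conj {κ l l' t : ℝ} {ζ : ℂ} (hζ : ‖ζ‖ = 1) :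
    (starRingEnd ℂ) (dualG κ l l' t ζ) = dualGConj κ l l' t ζ := by
  have h : (starRingEnd ℂ) ζ = ζ⁻¹ := (Complex.inv_eq_conj hζ).symm
  simp only [dualG, dualGConj, map_mul, map_neg, map_add, map_sub, map_pow, map_inv₀, h,
    Complex.conj_ofReal, inv_inv, Complex.conj_ofNat]
  ring

theorem dualStep_add_smul (κ l l' t : ℝ) (z ζ α β : ℂ) (y y' : ℂ × ℂ) :
    dualStep κ l l' t z ζ (α • y + β • y') =
      α • dualStep κ l l' t z ζ y + β • dualStep κ l l' t z ζ y' := by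
  ext <;> simp only [dualStep, Prod.fst_add, Prod.snd_add, Prod.smul_fst, Prod.smul_snd,
    smul_eq_mul] <;> ring

/-- The dual cocycle commutes with the antiunitary swap. -/
theorem dualStep_conj_swap {κ l l' t : ℝ} {z ζ : ℂ} (hz : ‖z‖ = 1) (hζ : ‖ζ‖ = 1) (y : ℂ × ℂ) :
    dualStep κ l l' t z ζ ((starRingEnd ℂ) y.2, (starRingEnd ℂ) y.1) =
      ((starRingEnd ℂ) (dualStep κ l l' t z ζ y).2,
        (starRingEnd ℂ) (dualStep κ l l' t z ζ y).1) := by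
  have h : (starRingEnd ℂ) z = z⁻¹ := (Complex.inv_eq_conj hz).symm
  have h1 := dualG_conj (κ := κ) (l := l) (l' := l') (t := t) hζ
  have h2 : (starRingEnd ℂ) (dualGConj κ l l' t ζ) = dualG κ l l' t ζ := by
    rw [← h1, Complex.conj_conj]
  ext <;> simp only [dualStep, map_add, map_mul, h, h1, h2, Complex.conj_ofReal, map_inv₀,
    inv_inv] <;> ring

/-- After removing the leading power `ζ ^ n`, the orbit of an eigenvector of the leading
coefficient is entire in `ζ⁻¹`, with an explicit value at `0`. -/
theorem exists_differentiable_dualOrbit {κ l l' t c : ℝ}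
    (hc : c ^ 2 - (1 - t ^ 2) * l' * c + t ^ 2 * l ^ 2 = 0) (hl' : l ^ 2 + l' ^ 2 = 1) (z : ℂ)
    {w : ℂ} (hw : ‖w‖ = 1) (n : ℕ) :
    ∃ p r : ℂ → ℂ, Differentiable ℂ p ∧ Differentiable ℂ r ∧
      (∀ ζ : ℂ, ζ ≠ 0 → dualOrbit κ l l' t z w (1, l' * t ^ 2 + c) n ζ =
        (ζ ^ n * p ζ⁻¹, ζ ^ n * r ζ⁻¹)) ∧
      ‖p 0‖ = |l * κ * c| ^ n ∧ r 0 = (l' * t ^ 2 + c) * p 0 := by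
  induction n with
  | zero =>
    exact ⟨fun _ => 1, fun _ => l' * t ^ 2 + c, by fun_prop, by fun_prop,
      fun ζ _ => by simp [dualOrbit], by simp, by simp⟩
  | succ n ih =>
    obtain ⟨p, r, hp, hr, hY, hp0, hr0⟩ := ih
    have hC : (c : ℂ) ^ 2 - (1 - t ^ 2) * l' * c + t ^ 2 * l ^ 2 = 0 := by exact_mod_cast hc
    have hL : (l : ℂ) ^ 2 + (l' : ℂ) ^ 2 = 1 := by exact_mod_cast hl'
    refine ⟨fun ξ => (z * ξ + l' * (κ * (t ^ 2 * l * w ^ n - 2 * t * l' * ξ -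
          l * (w ^ n)⁻¹ * ξ ^ 2))) * p ξ +
        (-κ * (l * w ^ n + 2 * t * l' * ξ - t ^ 2 * l * (w ^ n)⁻¹ * ξ ^ 2) + l' * z⁻¹ * ξ) * r ξ,
      fun ξ => (l' * z * ξ + κ * (t ^ 2 * l * w ^ n - 2 * t * l' * ξ -
          l * (w ^ n)⁻¹ * ξ ^ 2)) * p ξ +
        (l' * (-κ * (l * w ^ n + 2 * t * l' * ξ - t ^ 2 * l * (w ^ n)⁻¹ * ξ ^ 2)) + z⁻¹ * ξ) * r ξ,
      by fun_prop, by fun_prop, ?_, ?_, ?_⟩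
    · intro ζ hζ
      have hζ1 : ζ * ζ⁻¹ = 1 := mul_inv_cancel₀ hζ
      rw [dualOrbit, hY ζ hζ]
      ext
      · simp only [dualStep, dualG, dualGConj, mul_inv]
        rw [pow_succ]
        linear_combination (ζ ^ n * (-z * p ζ⁻¹ + 2 * l' * κ * t * r ζ⁻¹ +
          l' * κ * l * (w ^ n)⁻¹ * ζ⁻¹ * p ζ⁻¹ - l' * z⁻¹ * r ζ⁻¹ + 2 * l' ^ 2 * κ * t * p ζ⁻¹ -
          κ * t ^ 2 * l * (w ^ n)⁻¹ * ζ⁻¹ * r ζ⁻¹)) * hζ1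
      · simp only [dualStep, dualG, dualGConj, mul_inv]
        rw [pow_succ]
        linear_combination (ζ ^ n * (-l' * z * p ζ⁻¹ + 2 * l' * κ * t * p ζ⁻¹ -
          l' * κ * t ^ 2 * l * (w ^ n)⁻¹ * ζ⁻¹ * r ζ⁻¹ + 2 * l' ^ 2 * κ * t * r ζ⁻¹ +
          κ * l * (w ^ n)⁻¹ * ζ⁻¹ * p ζ⁻¹ - z⁻¹ * r ζ⁻¹)) * hζ1
    · have : (z * 0 + l' * (κ * (t ^ 2 * l * w ^ n - 2 * t * l' * 0 -
          l * (w ^ n)⁻¹ * 0 ^ 2))) * p 0 +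
        (-κ * (l * w ^ n + 2 * t * l' * 0 - t ^ 2 * l * (w ^ n)⁻¹ * 0 ^ 2) + l' * z⁻¹ * 0) * r 0
          = -(((l * κ * c : ℝ) : ℂ) * w ^ n * p 0) := by
        rw [hr0]
        push_cast
        ring
      simp only [this]
      rw [norm_neg, norm_mul, norm_mul, norm_pow, hw, hp0, one_pow, Complex.norm_real,
        Real.norm_eq_abs]
      ring
    · simp only [hr0]
      linear_combination (κ * l * w ^ n * p 0) * (hC - t ^ 2 * hL)

/-- A solution of the dual cocycle equation along an orbit, together with its image under the
antiunitary swap, reproduces every orbit of the cocycle up to the determinant `δ`. -/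
theorem smul_dualOrbit_eq {κ l l' t Λ s : ℝ} {z w τ ζ : ℂ} (hz : ‖z‖ = 1) (hw : ‖w‖ = 1)
    (hζ : ‖ζ‖ = 1) {a b : ℕ → ℂ}
    (h : ∀ n, (Λ * ((1 + s * (w ^ n * ζ)) * (1 + s * (w ^ n * ζ)⁻¹)) * τ) • (a (n + 1), b (n + 1)) =
      dualStep κ l l' t z (w ^ n * ζ) (a n, b n)) (β : ℝ) (n : ℕ) :
    (a 0 * (starRingEnd ℂ) (a 0) - b 0 * (starRingEnd ℂ) (b 0)) •
        dualOrbit κ l l' t z w (1, β) n ζ =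
      (Λ ^ n * birkhoffProd s w n ζ) •
        (τ ^ n * ((starRingEnd ℂ) (a 0) - β * (starRingEnd ℂ) (b 0))) • (a n, b n) +
      (Λ ^ n * birkhoffProd s w n ζ) •
        ((starRingEnd ℂ) τ ^ n * (-b 0 + β * a 0)) •
          ((starRingEnd ℂ) (b n), (starRingEnd ℂ) (a n)) := by
  induction n with
  | zero =>
    ext <;> simp [dualOrbit, birkhoffProd] <;> ring
  | succ n ih =>
    have hζn : ‖w ^ n * ζ‖ = 1 := by rw [norm_mul, norm_pow, hw, hζ, one_pow, one_mul]
    have hcj : (starRingEnd ℂ) (w ^ n * ζ) = (w ^ n * ζ)⁻¹ := (Complex.inv_eq_conj hζn).symm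
    have h2 := dualStep_conj_swap (κ := κ) (l := l) (l' := l') (t := t) hz hζn (a n, b n)
    rw [← h n] at h2
    have h0 : ∀ α y, dualStep κ l l' t z (w ^ n * ζ) (α • y) =
        α • dualStep κ l l' t z (w ^ n * ζ) y := fun α y => by
      simpa using dualStep_add_smul κ l l' t z (w ^ n * ζ) α 0 y 0
    have hsucc : birkhoffProd s w (n + 1) ζ = birkhoffProd s w n ζ *
        ((1 + s * (w ^ n * ζ)) * (1 + s * (w ^ n * ζ)⁻¹)) := by
      rw [birkhoffProd, Finset.prod_range_succ, birkhoffProd]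
    rw [dualOrbit, ← h0, ih, smul_smul, smul_smul, dualStep_add_smul, ← h n, h2, hsucc]
    ext <;> simp only [Prod.fst_add, Prod.snd_add, Prod.smul_fst, Prod.smul_snd, smul_eq_mul,
      map_mul, map_add, map_one, Complex.conj_ofReal, hcj, map_inv₀, inv_inv] <;> ring

theorem fourier_one_coe (Φ : ℝ) :
    (fourier 1 (Φ : UnitAddCircle) : ℂ) = Complex.exp (2 * Real.pi * Complex.I * Φ) := by
  rw [fourier_coe_apply]
  simp

/-- An almost everywhere property holds almost everywhere along whole forward orbits. -/
theorem ae_forall_add_nsmul {P : UnitAddCircle → Prop}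
    (hP : ∀ᵐ x ∂(AddCircle.haarAddCircle (T := 1)), P x) (a : UnitAddCircle) :
    ∀ᵐ x ∂(AddCircle.haarAddCircle (T := 1)), ∀ n : ℕ, P (x + n • a) :=
  ae_all_iff.2 fun n => (measurePreserving_add_right (AddCircle.haarAddCircle (T := 1))
    (n • a)).quasiMeasurePreserving.ae hP

theorem integrable_birkhoffProd_mul {s w : ℂ} (hw : w ≠ 0) (n : ℕ) (m : ℤ) (y : UnitAddCircle)
    {u v : UnitAddCircle → ℂ} (hu : MemLp u 2 AddCircle.haarAddCircle)
    (hv : MemLp v 2 AddCircle.haarAddCircle) :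
    Integrable (fun x => birkhoffProd s w n (fourier 1 x) * fourier m x * u (x + y) *
      (starRingEnd ℂ) (v x)) (AddCircle.haarAddCircle (T := 1)) := by
  have h1 := (hu.comp_measurePreserving
    (measurePreserving_add_right (AddCircle.haarAddCircle (T := 1)) y)).integrable_mul hv.star
  have hc : Continuous fun x : UnitAddCircle =>
      birkhoffProd s w n (fourier 1 x) * (fourier m x : ℂ) :=
    (continuous_birkhoffProd_fourier hw n).mul (fourier m).continuous
  obtain ⟨C, hC⟩ := (isCompact_univ (X := UnitAddCircle)).exists_bound_of_continuousOn
    hc.continuousOn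
  refine (h1.bdd_mul (c := C) hc.aestronglyMeasurable
    (.of_forall fun x => hC x (Set.mem_univ x))).congr (.of_forall fun x => ?_)
  simp only [Pi.mul_apply, Function.comp_apply, Pi.star_apply, RCLike.star_def]
  ring

/-- The conserved determinant of an `L²` solution of the dual cocycle vanishes. -/
theorem eq_zero_of_dual_cocycle {t l l' c κ s Φ : ℝ} {z τ δ : ℂ} (hΛ : l * κ * c ≠ 0)
    (hL : l ^ 2 + l' ^ 2 = 1) (hc : c ^ 2 - (1 - t ^ 2) * l' * c + t ^ 2 * l ^ 2 = 0)
    (hs : |s| < 1) (hΦ : Irrational Φ) (hz : ‖z‖ = 1) (hτ : ‖τ‖ = 1)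
    {a b : UnitAddCircle → ℂ} (ha : MemLp a 2 AddCircle.haarAddCircle)
    (hb : MemLp b 2 AddCircle.haarAddCircle)
    (hcoc : ∀ᵐ x ∂(AddCircle.haarAddCircle (T := 1)),
      ((l * κ * c : ℝ) * ((1 + s * fourier 1 x) * (1 + s * (fourier 1 x)⁻¹)) * τ) •
        (a (x + (Φ : UnitAddCircle)), b (x + (Φ : UnitAddCircle))) =
      dualStep κ l l' t z (fourier 1 x) (a x, b x))
    (hδ : ∀ᵐ x ∂(AddCircle.haarAddCircle (T := 1)),
      a x * (starRingEnd ℂ) (a x) - b x * (starRingEnd ℂ) (b x) = δ) : δ = 0 := by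
  set w := Complex.exp (2 * Real.pi * Complex.I * Φ) with hw
  have hwΦ : (fourier 1 (Φ : UnitAddCircle) : ℂ) = w := fourier_one_coe Φ
  have hw1 : ‖w‖ = 1 := by rw [← hwΦ, norm_fourier_apply]
  have hw0 : w ≠ 0 := Complex.exp_ne_zero _
  set β : ℝ := l' * t ^ 2 + c with hβ
  let v : UnitAddCircle → ℂ := fun x => a x - β * b x
  let v' : UnitAddCircle → ℂ := fun x => -(starRingEnd ℂ) (b x) + β * (starRingEnd ℂ) (a x)
  let b' : UnitAddCircle → ℂ := fun x => (starRingEnd ℂ) (b x)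
  have hb' : MemLp b' 2 AddCircle.haarAddCircle := hb.star
  have hv : MemLp v 2 AddCircle.haarAddCircle := ha.sub (hb.const_mul _)
  have hv' : MemLp v' 2 AddCircle.haarAddCircle := hb.star.neg.add (ha.star.const_mul _)
  let J (n : ℕ) (u v : UnitAddCircle → ℂ) : ℂ := ∫ x : UnitAddCircle,
      birkhoffProd s w n (fourier 1 x) * fourier (-(n : ℤ)) x *
        u (x + n • (Φ : UnitAddCircle)) * (starRingEnd ℂ) (v x) ∂AddCircle.haarAddCircle
  have key : ∀ n : ℕ, ‖δ‖ ≤ ‖J n a v‖ + ‖J n b' v'‖ := by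
    intro n
    obtain ⟨p, r, hp, -, hY, hp0, -⟩ := exists_differentiable_dualOrbit (κ := κ) hc hL z hw1 n
    have hint : ∫ x : UnitAddCircle, δ * p (fourier (-1) x) ∂AddCircle.haarAddCircle =
        (l * κ * c : ℝ) ^ n * (τ ^ n * J n a v + (starRingEnd ℂ) τ ^ n * J n b' v') := by
      rw [← integral_const_mul, ← integral_const_mul, ← integral_add
        ((integrable_birkhoffProd_mul hw0 n _ _ ha hv).const_mul _)
        ((integrable_birkhoffProd_mul hw0 n _ _ hb' hv').const_mul _), ← integral_const_mul]
      refine integral_congr_ae ?_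
      filter_upwards [ae_forall_add_nsmul hcoc (Φ : UnitAddCircle), hδ] with x hx hδx
      have hx' := smul_dualOrbit_eq (κ := κ) (l := l) (l' := l') (t := t) (Λ := l * κ * c)
        (s := s) (τ := τ) (ζ := fourier 1 x) (a := fun n => a (x + n • (Φ : UnitAddCircle)))
        (b := fun n => b (x + n • (Φ : UnitAddCircle))) hz hw1 (norm_fourier_apply 1 x) ?_ β n
      · have hne : (fourier 1 x : ℂ) ≠ 0 :=
          norm_ne_zero_iff.1 (by rw [norm_fourier_apply]; exact one_ne_zero)
        have h1 : (fourier (-1) x : ℂ) = (fourier 1 x)⁻¹ := by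
          rw [fourier_neg, Complex.inv_eq_conj (norm_fourier_apply 1 x)]
        have h2 : (fourier (-(n : ℤ)) x : ℂ) = ((fourier 1 x) ^ n)⁻¹ := by
          rw [fourier_apply, fourier_one, neg_smul, AddCircle.toCircle_neg, natCast_zsmul,
            AddCircle.toCircle_nsmul, Circle.coe_inv, Circle.coe_pow]
        have h3 := congrArg Prod.fst hx'
        have hβ' : (β : ℂ) = l' * t ^ 2 + c := by rw [hβ]; push_cast; ring
        rw [hβ', hY _ hne, ← hβ'] at h3
        simp only [zero_smul, add_zero, hδx, Prod.smul_fst, Prod.fst_add, smul_eq_mul] at h3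
        rw [h1, h2]
        have h4 : δ * p (fourier 1 x)⁻¹ = ((fourier 1 x : ℂ) ^ n)⁻¹ *
            (δ * ((fourier 1 x) ^ n * p (fourier 1 x)⁻¹)) := by
          field_simp
        rw [h4, h3]
        simp only [v, v', b', map_sub, map_mul, map_add, map_neg, Complex.conj_ofReal,
          Complex.conj_conj]
        ring
      · intro m
        have h5 : w ^ m * (fourier 1 x : ℂ) = fourier 1 (x + m • (Φ : UnitAddCircle)) := by
          rw [fourier_add_apply, fourier_natCast_mul, hwΦ, mul_comm]
        rw [h5, ← hx m, succ_nsmul, add_assoc]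
    rw [integral_const_mul, integral_fourier_neg_one_of_differentiable hp] at hint
    have h6 := congrArg norm hint
    rw [norm_mul, hp0, norm_mul, norm_pow, Complex.norm_real, Real.norm_eq_abs, mul_comm] at h6
    have h7 := mul_left_cancel₀ (pow_ne_zero _ (abs_ne_zero.2 hΛ)) h6
    rw [h7]
    refine (norm_add_le _ _).trans (le_of_eq ?_)
    simp [hτ]
  choose q hq1 hq2 using fun N => hΦ.exists_rat_abs_sub_lt_and_le_den N
  have hq : Filter.Tendsto (fun k => (q k).den) Filter.atTop Filter.atTop :=
    Filter.tendsto_atTop_mono hq2 Filter.tendsto_id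
  have hs' : ‖(s : ℂ)‖ < 1 := by rwa [Complex.norm_real]
  have hlim := (tendsto_integral_birkhoffProd hq1 hq hs' ha hv).norm.add
    (tendsto_integral_birkhoffProd hq1 hq hs' hb' hv').norm
  rw [norm_zero, add_zero] at hlim
  exact norm_le_zero_iff.1 (ge_of_tendsto' hlim fun k => key _)

theorem ae_eq_of_fourierCoeff_eq {u v : UnitAddCircle → ℂ}
    (hu : MemLp u 2 AddCircle.haarAddCircle) (hv : MemLp v 2 AddCircle.haarAddCircle)
    (h : ∀ n, fourierCoeff u n = fourierCoeff v n) : u =ᵐ[AddCircle.haarAddCircle] v := by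
  have h1 : hu.toLp u = hv.toLp v := by
    refine fourierBasis.repr.injective (lp.ext (funext fun n => ?_))
    rw [fourierBasis_repr, fourierBasis_repr, fourierCoeff_congr_ae hu.coeFn_toLp,
      fourierCoeff_congr_ae hv.coeFn_toLp, h]
  exact (MemLp.toLp_eq_toLp_iff hu hv).1 h1

theorem fourierCoeff_comp_add_right (u : UnitAddCircle → ℂ) (y : UnitAddCircle) (n : ℤ) :
    fourierCoeff (fun x => u (x + y)) n = fourier n y * fourierCoeff u n := by
  rw [fourierCoeff, fourierCoeff, ← integral_add_right_eq_self (μ := AddCircle.haarAddCircle)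
    (fun x : UnitAddCircle => (fourier (-n) x : ℂ) • u x) y, ← integral_const_mul]
  refine integral_congr_ae (.of_forall fun x => ?_)
  have h1 : (fourier n y : ℂ) * fourier (-n) y = 1 := by
    rw [← fourier_add, add_neg_cancel, fourier_zero]
  simp only [smul_eq_mul, fourier_add_apply]
  linear_combination (-(fourier (-n) x : ℂ) * u (x + y)) * h1

theorem fourierCoeff_fourier_mul (u : UnitAddCircle → ℂ) (k n : ℤ) :
    fourierCoeff (fun x => fourier k x * u x) n = fourierCoeff u (n - k) := by
  refine integral_congr_ae (.of_forall fun x => ?_)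
  simp only [smul_eq_mul]
  rw [← mul_assoc, ← fourier_add, neg_sub, sub_eq_neg_add]

theorem ergodic_add_right_of_irrational {Φ : ℝ} (hΦ : Irrational Φ) :
    Ergodic (· + (Φ : UnitAddCircle)) (AddCircle.haarAddCircle (T := 1)) := by
  have h : addOrderOf (Φ : UnitAddCircle) = 0 := by
    rw [addOrderOf_eq_zero_iff']
    intro n hn h0
    rw [← AddCircle.coe_nsmul, AddCircle.coe_eq_zero_iff] at h0
    obtain ⟨m, hm⟩ := h0
    simp only [nsmul_eq_mul, zsmul_eq_mul, mul_one] at hm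
    refine hΦ ⟨(m : ℚ) / n, ?_⟩
    have : (n : ℝ) ≠ 0 := by exact_mod_cast hn.ne'
    push_cast
    rw [hm]
    field_simp
  have := AddCircle.ergodic_add_right.2 h
  rwa [AddCircle.volume_eq_smul_haarAddCircle, ENNReal.ofReal_one, one_smul] at this

/-- A bounded function which is multiplied by `τ ^ 2` under the rotation by `Φ` vanishes unless
`τ ^ 2` is an eigenvalue of the rotation. -/
theorem ae_eq_zero_of_comp_add_eq_mul_s2 {Φ : ℝ} {τ : ℂ}
    (hτ : ∀ n : ℤ, (fourier n (Φ : UnitAddCircle) : ℂ) ≠ τ ^ 2)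
    {g : UnitAddCircle → ℂ} (hg : MemLp g 2 AddCircle.haarAddCircle)
    (h : ∀ᵐ x ∂(AddCircle.haarAddCircle (T := 1)), g (x + (Φ : UnitAddCircle)) = τ ^ 2 * g x) :
    g =ᵐ[AddCircle.haarAddCircle] 0 := by
  refine ae_eq_of_fourierCoeff_eq hg MemLp.zero fun n => ?_
  have h1 := fourierCoeff_comp_add_right g (Φ : UnitAddCircle) n
  rw [fourierCoeff_congr_ae h, fourierCoeff.const_mul] at h1
  have h2 : fourierCoeff g n = 0 := by
    have : (fourier n (Φ : UnitAddCircle) - τ ^ 2) * fourierCoeff g n = 0 := by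
      linear_combination -h1
    exact (mul_eq_zero.1 this).resolve_left (sub_ne_zero.2 (hτ n))
  rw [h2]
  simp [fourierCoeff]

/-- The diagonal entry of the dual coin, as a Laurent polynomial in `ζ`. -/
def dualF (κ l l' t : ℝ) (ζ : ℂ) : ℂ := κ * ((1 - t ^ 2) * l' - t * l * (ζ + ζ⁻¹))

theorem dualF_sq_add {κ l l' t : ℝ} (hκ : κ * (1 + t ^ 2) = 1) (hL : l ^ 2 + l' ^ 2 = 1) {ζ : ℂ}
    (hζ : ζ ≠ 0) :
    dualF κ l l' t ζ ^ 2 + dualG κ l l' t ζ * dualGConj κ l l' t ζ = 1 := by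
  have h1 : ζ * ζ⁻¹ = 1 := mul_inv_cancel₀ hζ
  have hκ' : (κ : ℂ) * (1 + t ^ 2) = 1 := by exact_mod_cast hκ
  have hL' : (l : ℂ) ^ 2 + l' ^ 2 = 1 := by exact_mod_cast hL
  have h2 : dualF κ l l' t ζ ^ 2 + dualG κ l l' t ζ * dualGConj κ l l' t ζ =
      (κ * (1 + t ^ 2)) ^ 2 * (l ^ 2 + l' ^ 2) := by
    simp only [dualF, dualG, dualGConj]
    linear_combination (κ ^ 2 * l ^ 2 * (1 + t ^ 2) ^ 2 : ℂ) * h1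
  rw [h2, hκ', hL']
  ring

theorem dualF_eq_mul {κ l l' t c s : ℝ} (hc : c ^ 2 - (1 - t ^ 2) * l' * c + t ^ 2 * l ^ 2 = 0)
    (hc0 : c ≠ 0) (hsc : s * c = -(t * l)) {ζ : ℂ} (hζ : ζ ≠ 0) :
    dualF κ l l' t ζ = κ * c * ((1 + s * ζ) * (1 + s * ζ⁻¹)) := by
  have h1 : ζ * ζ⁻¹ = 1 := mul_inv_cancel₀ hζ
  have h2 : (1 - t ^ 2) * l' = c * (1 + s ^ 2) := by
    apply mul_left_cancel₀ hc0
    linear_combination -hc - (s * c - t * l) * hsc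
  have h2' : ((1 : ℂ) - t ^ 2) * l' = c * (1 + s ^ 2) := by exact_mod_cast h2
  have hsc' : (s : ℂ) * c = -(t * l) := by exact_mod_cast hsc
  rw [dualF, h2']
  linear_combination (-(κ : ℂ) * (ζ + ζ⁻¹)) * hsc' - (κ * c * s ^ 2 : ℂ) * h1

/-- An `L²` solution of the dual cocycle equation vanishes. -/
theorem ae_eq_zero_of_dual_cocycle {t l l' c κ s Φ : ℝ} {z τ : ℂ} (hl : l ≠ 0) (hc0 : c ≠ 0)
    (hκ : κ * (1 + t ^ 2) = 1) (hL : l ^ 2 + l' ^ 2 = 1)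
    (hc : c ^ 2 - (1 - t ^ 2) * l' * c + t ^ 2 * l ^ 2 = 0) (hsc : s * c = -(t * l))
    (hs : |s| < 1) (hΦ : Irrational Φ) (hz : ‖z‖ = 1) (hτ : ‖τ‖ = 1)
    (hτΦ : ∀ n : ℤ, (fourier n (Φ : UnitAddCircle) : ℂ) ≠ τ ^ 2)
    {a b : UnitAddCircle → ℂ} (ha : MemLp a 2 AddCircle.haarAddCircle)
    (hb : MemLp b 2 AddCircle.haarAddCircle)
    (hcoc : ∀ᵐ x ∂(AddCircle.haarAddCircle (T := 1)),
      (l * dualF κ l l' t (fourier 1 x) * τ) •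
        (a (x + (Φ : UnitAddCircle)), b (x + (Φ : UnitAddCircle))) =
      dualStep κ l l' t z (fourier 1 x) (a x, b x)) :
    a =ᵐ[AddCircle.haarAddCircle] 0 ∧ b =ᵐ[AddCircle.haarAddCircle] 0 := by
  have hκ0 : κ ≠ 0 := left_ne_zero_of_mul_eq_one hκ
  have hzc : (starRingEnd ℂ) z = z⁻¹ := (Complex.inv_eq_conj hz).symm
  have hz0 : z ≠ 0 := norm_ne_zero_iff.1 (by rw [hz]; exact one_ne_zero)
  have hzz : z * z⁻¹ = 1 := mul_inv_cancel₀ hz0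
  have hτ0 : τ ≠ 0 := norm_ne_zero_iff.1 (by rw [hτ]; exact one_ne_zero)
  have hττ : τ * (starRingEnd ℂ) τ = 1 := by
    rw [← Complex.inv_eq_conj hτ, mul_inv_cancel₀ hτ0]
  have hL' : (l : ℂ) ^ 2 + l' ^ 2 = 1 := by exact_mod_cast hL
  have hlC : (l : ℂ) ≠ 0 := by exact_mod_cast hl
  have hζ0 : ∀ x : UnitAddCircle, (fourier 1 x : ℂ) ≠ 0 := fun x =>
    norm_ne_zero_iff.1 (by rw [norm_fourier_apply]; exact one_ne_zero)
  have hF0 : ∀ x : UnitAddCircle, dualF κ l l' t (fourier 1 x) ≠ 0 := by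
    intro x
    have h1 : ∀ y : ℂ, ‖y‖ = 1 → 1 + s * y ≠ 0 := by
      intro y hy h0
      have h2 : ‖(s : ℂ) * y‖ = ‖(-1 : ℂ)‖ := by
        congr 1
        linear_combination h0
      rw [norm_mul, hy, Complex.norm_real, Real.norm_eq_abs, norm_neg, norm_one, mul_one] at h2
      exact hs.ne h2
    rw [dualF_eq_mul hc hc0 hsc (hζ0 x)]
    refine mul_ne_zero (mul_ne_zero ?_ ?_) (mul_ne_zero ?_ ?_)
    · exact_mod_cast hκ0
    · exact_mod_cast hc0
    · exact h1 _ (norm_fourier_apply 1 x)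
    · exact h1 _ (by rw [norm_inv, norm_fourier_apply, inv_one])
  have hFc : ∀ x : UnitAddCircle, (starRingEnd ℂ) (dualF κ l l' t (fourier 1 x)) =
      dualF κ l l' t (fourier 1 x) := by
    intro x
    have h : (starRingEnd ℂ) (fourier 1 x) = (fourier 1 x : ℂ)⁻¹ :=
      (Complex.inv_eq_conj (norm_fourier_apply 1 x)).symm
    simp only [dualF, map_mul, map_sub, map_add, map_one, map_pow, Complex.conj_ofReal, map_inv₀, h,
      inv_inv]
    ring
  have hG : ∀ x : UnitAddCircle, (starRingEnd ℂ) (dualG κ l l' t (fourier 1 x)) =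
      dualGConj κ l l' t (fourier 1 x) := fun x => dualG_conj (norm_fourier_apply 1 x)
  have hGc : ∀ x : UnitAddCircle, (starRingEnd ℂ) (dualGConj κ l l' t (fourier 1 x)) =
      dualG κ l l' t (fourier 1 x) := fun x => by rw [← hG, Complex.conj_conj]
  have hcons : ∀ᵐ x ∂(AddCircle.haarAddCircle (T := 1)),
      a (x + (Φ : UnitAddCircle)) * (starRingEnd ℂ) (a (x + (Φ : UnitAddCircle))) -
        b (x + (Φ : UnitAddCircle)) * (starRingEnd ℂ) (b (x + (Φ : UnitAddCircle))) =
      a x * (starRingEnd ℂ) (a x) - b x * (starRingEnd ℂ) (b x) := by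
    filter_upwards [hcoc] with x hx
    have h1 := congrArg Prod.fst hx
    have h2 := congrArg Prod.snd hx
    simp only [Prod.smul_fst, Prod.smul_snd, smul_eq_mul, dualStep] at h1 h2
    have h3 := congrArg (starRingEnd ℂ) h1
    have h4 := congrArg (starRingEnd ℂ) h2
    simp only [map_mul, map_add, hFc, hG, hGc, Complex.conj_ofReal, hzc, map_inv₀, inv_inv] at h3 h4
    have hsum := dualF_sq_add hκ hL (hζ0 x)
    have hne : ((l : ℂ) * dualF κ l l' t (fourier 1 x)) ^ 2 ≠ 0 :=
      pow_ne_zero _ (mul_ne_zero hlC (hF0 x))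
    apply mul_left_cancel₀ hne
    have h5 : (l * dualF κ l l' t (fourier 1 x)) ^ 2 *
        (a (x + (Φ : UnitAddCircle)) * (starRingEnd ℂ) (a (x + (Φ : UnitAddCircle)))) = _ :=
      Eq.trans (by linear_combination (-(l * dualF κ l l' t (fourier 1 x)) ^ 2 *
        (a (x + (Φ : UnitAddCircle)) * (starRingEnd ℂ) (a (x + (Φ : UnitAddCircle))))) * hττ)
        (congrArg₂ (· * ·) h1 h3)
    have h6 : (l * dualF κ l l' t (fourier 1 x)) ^ 2 *
        (b (x + (Φ : UnitAddCircle)) * (starRingEnd ℂ) (b (x + (Φ : UnitAddCircle)))) = _ :=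
      Eq.trans (by linear_combination (-(l * dualF κ l l' t (fourier 1 x)) ^ 2 *
        (b (x + (Φ : UnitAddCircle)) * (starRingEnd ℂ) (b (x + (Φ : UnitAddCircle))))) * hττ)
        (congrArg₂ (· * ·) h2 h4)
    rw [mul_sub, h5, h6]
    linear_combination (a x * (starRingEnd ℂ) (a x) - b x * (starRingEnd ℂ) (b x)) *
      (l ^ 2 * hzz - l ^ 2 * hsum -
        (z * z⁻¹ - dualG κ l l' t (fourier 1 x) * dualGConj κ l l' t (fourier 1 x)) * hL')
  obtain ⟨δ, hδ⟩ := (ergodic_add_right_of_irrational hΦ).ae_eq_const_of_ae_eq_comp_ae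
    (g := fun x => a x * (starRingEnd ℂ) (a x) - b x * (starRingEnd ℂ) (b x))
    ((ha.1.mul ha.star.1).sub (hb.1.mul hb.star.1)) hcons
  have hδ0 : δ = 0 := by
    refine eq_zero_of_dual_cocycle (l := l) (κ := κ) (c := c) (s := s) (t := t) (l' := l') (by positivity) hL hc hs hΦ hz hτ ha hb ?_ hδ
    filter_upwards [hcoc] with x hx
    rw [← hx, dualF_eq_mul hc hc0 hsc (hζ0 x)]
    congr 1
    push_cast
    ring
  have hnorm : ∀ᵐ x ∂(AddCircle.haarAddCircle (T := 1)),
      a x * (starRingEnd ℂ) (a x) = b x * (starRingEnd ℂ) (b x) := by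
    filter_upwards [hδ] with x hx
    exact sub_eq_zero.1 (hx.trans hδ0)
  have hab : ∀ᵐ x ∂(AddCircle.haarAddCircle (T := 1)), ‖a x‖ = ‖b x‖ := by
    filter_upwards [hnorm] with x hx
    rw [Complex.mul_conj, Complex.mul_conj, Complex.ofReal_inj, Complex.normSq_eq_norm_sq,
      Complex.normSq_eq_norm_sq] at hx
    exact (sq_eq_sq₀ (norm_nonneg _) (norm_nonneg _)).1 hx
  have hg : MemLp (fun x => (starRingEnd ℂ) (b x) / a x) 2 (AddCircle.haarAddCircle (T := 1)) := by
    refine MemLp.of_bound (hb.star.1.aemeasurable.div ha.1.aemeasurable).aestronglyMeasurable 1 ?_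
    filter_upwards [hab] with x hx
    rw [norm_div, RCLike.norm_conj, hx]
    exact div_self_le_one _
  have hzero : (fun x => (starRingEnd ℂ) (b x) / a x) =ᵐ[AddCircle.haarAddCircle] 0 := by
    refine ae_eq_zero_of_comp_add_eq_mul_s2 hτΦ hg ?_
    have hab' := (measurePreserving_add_right (AddCircle.haarAddCircle (T := 1))
      (Φ : UnitAddCircle)).quasiMeasurePreserving.ae hab
    filter_upwards [hcoc, hnorm, hab, hab'] with x hx hn hab hab'
    have h1 := congrArg Prod.fst hx
    have h2 := congrArg Prod.snd hx
    simp only [Prod.smul_fst, Prod.smul_snd, smul_eq_mul, dualStep] at h1 h2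
    have hlF : (l : ℂ) * dualF κ l l' t (fourier 1 x) ≠ 0 := mul_ne_zero hlC (hF0 x)
    by_cases hax : a x = 0
    · have hbx : b x = 0 := norm_eq_zero.1 (by rw [← hab, hax, norm_zero])
      rw [hax, hbx] at h1
      have : a (x + (Φ : UnitAddCircle)) = 0 := by
        refine (mul_eq_zero.1 (h1.trans (by ring))).resolve_left (mul_ne_zero hlF hτ0)
      rw [this, hax, div_zero, div_zero, mul_zero]
    · have hax' : a (x + (Φ : UnitAddCircle)) ≠ 0 := by
        intro h0
        have hb0 : b (x + (Φ : UnitAddCircle)) = 0 := norm_eq_zero.1 (by rw [← hab', h0, norm_zero])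
        rw [h0, mul_zero] at h1
        rw [hb0, mul_zero] at h2
        have hsum := dualF_sq_add hκ hL (hζ0 x)
        have h3 : ((l : ℂ) * dualF κ l l' t (fourier 1 x)) ^ 2 * a x = 0 := by
          linear_combination (l ^ 2 * a x) * (hsum - hzz) - z⁻¹ * (h1 - l' * h2) +
            dualG κ l l' t (fourier 1 x) * (h2 - l' * h1) +
            (z⁻¹ * (z * a x + dualG κ l l' t (fourier 1 x) * b x) -
              dualG κ l l' t (fourier 1 x) * (dualGConj κ l l' t (fourier 1 x) * a x + z⁻¹ * b x)) * hL'
        exact hax ((mul_eq_zero.1 h3).resolve_left (pow_ne_zero _ hlF))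
      have h4 := congrArg (starRingEnd ℂ) h2
      simp only [map_mul, map_add, hFc, hG, hGc, Complex.conj_ofReal, hzc, map_inv₀, inv_inv] at h4
      rw [div_eq_iff hax']
      have h5 : a x * (l * dualF κ l l' t (fourier 1 x)) *
          (starRingEnd ℂ) (b (x + (Φ : UnitAddCircle))) =
          a x * (l * dualF κ l l' t (fourier 1 x)) * (τ ^ 2 * ((starRingEnd ℂ) (b x) / a x) *
            a (x + (Φ : UnitAddCircle))) := by
        have h6 : a x * ((starRingEnd ℂ) (b x) / a x) = (starRingEnd ℂ) (b x) := by
          field_simp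
        linear_combination
          (-(a x * (l * dualF κ l l' t (fourier 1 x)) *
            (starRingEnd ℂ) (b (x + (Φ : UnitAddCircle))))) * hττ + τ * a x * h4 -
          τ * a x * ((starRingEnd ℂ) (b x) / a x) * h1 -
          τ * ((z + l' * dualGConj κ l l' t (fourier 1 x)) * a x + (dualG κ l l' t (fourier 1 x) + l' * z⁻¹) * b x) * h6 +
          τ * (l' * z⁻¹ + dualG κ l l' t (fourier 1 x)) * hn
      exact mul_left_cancel₀ (mul_ne_zero hax hlF) h5
  constructor
  · filter_upwards [hzero, hab] with x hx hab
    rcases div_eq_zero_iff.1 hx with h | h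
    · exact norm_eq_zero.1 (by rw [hab, ← RCLike.norm_conj, h, norm_zero])
    · exact h
  · filter_upwards [hzero, hab] with x hx hab
    rcases div_eq_zero_iff.1 hx with h | h
    · exact norm_eq_zero.1 (by rw [← RCLike.norm_conj, h, norm_zero])
    · exact norm_eq_zero.1 (by rw [← hab, h, norm_zero])

theorem sq1_sq_add {l : ℝ} (hl : l ^ 2 ≤ 1) : l ^ 2 + sq1 l ^ 2 = 1 := by
  rw [sq1, Real.sq_sqrt (by linarith)]
  ring

theorem fourier_one_inv (x : ℝ) :
    (fourier 1 (x : UnitAddCircle) : ℂ)⁻¹ = Complex.exp (-(2 * Real.pi * x) * Complex.I) := by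
  rw [fourier_one_coe, ← Complex.exp_neg]
  congr 1
  ring

theorem fS_eq_dualF (t l x : ℝ) :
    (fS t l x : ℂ) = dualF (1 / (1 + t ^ 2)) l (sq1 l) t (fourier 1 (x : UnitAddCircle)) := by
  have h : (2 * Real.cos (2 * Real.pi * x) : ℂ) = fourier 1 (x : UnitAddCircle) +
      (fourier 1 (x : UnitAddCircle) : ℂ)⁻¹ := by
    rw [fourier_one_inv, fourier_one_coe]
    push_cast
    rw [Complex.two_cos]
    congr 2
    ring
  rw [dualF, ← h, fS]
  push_cast
  rw [one_div_neg_eq_neg_one_div]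
  ring

theorem gS_eq_dualGConj (t l x : ℝ) :
    gS t l x = dualGConj (1 / (1 + t ^ 2)) l (sq1 l) t (fourier 1 (x : UnitAddCircle)) := by
  rw [dualGConj, fourier_one_inv, fourier_one_coe, gS,
    show (2 * Real.pi * x * Complex.I : ℂ) = 2 * Real.pi * Complex.I * x by ring]
  push_cast
  rw [one_div_neg_eq_neg_one_div]
  ring

/-- A nonzero square-summable eigenvector of a split-step walk has a unimodular eigenvalue. -/
theorem norm_eq_one_of_walk {l l' : ℝ} (hL : l ^ 2 + l' ^ 2 = 1) {p q φ χ : ℤ → ℂ} {z : ℂ}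
    (hp : Summable fun n => ‖p n‖ ^ 2) (hq : Summable fun n => ‖q n‖ ^ 2)
    (hcoin : ∀ n, ‖φ n‖ ^ 2 + ‖χ n‖ ^ 2 = ‖p n‖ ^ 2 + ‖q n‖ ^ 2)
    (h1 : ∀ n, z * p n = l * φ (n - 1) - l' * χ n)
    (h2 : ∀ n, z * q n = l * χ (n + 1) + l' * φ n) :
    ‖z‖ = 1 ∨ ∀ n, p n = 0 ∧ q n = 0 := by
  have hφ : Summable fun n => ‖φ n‖ ^ 2 :=
    (hp.add hq).of_nonneg_of_le (fun _ => by positivity)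
      fun n => by rw [← hcoin]; exact le_add_of_nonneg_right (by positivity)
  have hχ : Summable fun n => ‖χ n‖ ^ 2 :=
    (hp.add hq).of_nonneg_of_le (fun _ => by positivity)
      fun n => by rw [← hcoin]; exact le_add_of_nonneg_left (by positivity)
  have hshift : ∀ u : ℤ → ℝ, Summable u → HasSum (fun n => u (n + 1)) (∑' n, u n) := fun u hu =>
    (Equiv.addRight (1 : ℤ)).hasSum_iff.2 hu.hasSum
  have hrot : ∀ n, ‖z‖ ^ 2 * (‖p (n + 1)‖ ^ 2 + ‖q n‖ ^ 2) = ‖φ n‖ ^ 2 + ‖χ (n + 1)‖ ^ 2 := by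
    intro n
    have e1 := h1 (n + 1)
    have e2 := h2 n
    rw [add_sub_cancel_right] at e1
    rw [mul_add, ← mul_pow, ← mul_pow, ← norm_mul, ← norm_mul, e1, e2]
    have hL' : (l : ℂ) ^ 2 + l' ^ 2 = 1 := by exact_mod_cast hL
    rw [← Complex.ofReal_inj]
    push_cast
    simp only [← Complex.mul_conj', map_add, map_sub, map_mul, Complex.conj_ofReal]
    linear_combination (φ n * (starRingEnd ℂ) (φ n) +
      χ (n + 1) * (starRingEnd ℂ) (χ (n + 1))) * hL'
  have s1 := ((hshift _ hp).add hq.hasSum).mul_left (‖z‖ ^ 2)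
  have s2 := hφ.hasSum.add (hshift _ hχ)
  have s3 := (hφ.hasSum.add hχ.hasSum).unique
    ((hp.hasSum.add hq.hasSum).congr_fun hcoin)
  have s4 : ‖z‖ ^ 2 * (∑' n, ‖p n‖ ^ 2 + ∑' n, ‖q n‖ ^ 2) =
      ∑' n, ‖p n‖ ^ 2 + ∑' n, ‖q n‖ ^ 2 :=
    (s1.unique (s2.congr_fun hrot)).trans s3
  by_cases h0 : ∑' n, ‖p n‖ ^ 2 + ∑' n, ‖q n‖ ^ 2 = 0
  · right
    rw [h0] at s4
    have s5 := hp.hasSum.add hq.hasSum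
    rw [h0, hasSum_zero_iff_of_nonneg fun n => by positivity] at s5
    intro n
    have s6 := congrFun s5 n
    simp only [Pi.zero_apply] at s6
    rw [add_eq_zero_iff_of_nonneg (by positivity) (by positivity)] at s6
    simpa using s6
  · left
    have s5 : ‖z‖ ^ 2 = 1 := mul_right_cancel₀ h0 (by rw [s4, one_mul])
    exact (pow_eq_one_iff_of_nonneg (norm_nonneg z) two_ne_zero).1 s5

theorem exists_memLp_fourierCoeff_eq {η : ℤ → ℂ} (hη : Summable fun n => ‖η n‖ ^ 2) :
    ∃ a : UnitAddCircle → ℂ, MemLp a 2 AddCircle.haarAddCircle ∧ ∀ n, fourierCoeff a n = η n := by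
  have hmem : Memℓp η 2 := (memℓp_gen_iff (by norm_num)).2 (by simpa using hη)
  refine ⟨fourierBasis.repr.symm (⟨η, hmem⟩ : lp (fun _ : ℤ => ℂ) 2), Lp.memLp _, fun n => ?_⟩
  rw [← fourierBasis_repr, LinearIsometryEquiv.apply_symm_apply]

theorem memLp_continuous_mul {F u : UnitAddCircle → ℂ} (hF : Continuous F)
    (hu : MemLp u 2 AddCircle.haarAddCircle) :
    MemLp (fun x => F x * u x) 2 AddCircle.haarAddCircle := by
  obtain ⟨C, hC⟩ := (isCompact_univ (X := UnitAddCircle)).exists_bound_of_continuousOn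
    hF.continuousOn
  refine hu.of_le_mul (c := C) (hF.aestronglyMeasurable.mul hu.1) (.of_forall fun x => ?_)
  rw [norm_mul]
  exact mul_le_mul_of_nonneg_right (hC x (Set.mem_univ x)) (norm_nonneg _)

/-- Fourier coefficients of the product with a Laurent polynomial of degree one. -/
theorem fourierCoeff_laurent_mul {u : UnitAddCircle → ℂ} (hu : MemLp u 2 AddCircle.haarAddCircle)
    (α β γ : ℂ) (n : ℤ) :
    fourierCoeff (fun x => (α * fourier 1 x + β + γ * (fourier 1 x)⁻¹) * u x) n =
      α * fourierCoeff u (n - 1) + β * fourierCoeff u n + γ * fourierCoeff u (n + 1) := by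
  have hi : ∀ (k : ℤ) (c : ℂ), Integrable (fun x => c * ((fourier k x : ℂ) * u x))
      AddCircle.haarAddCircle := fun k c =>
    ((memLp_continuous_mul (fourier k).continuous hu).integrable (by norm_num)).const_mul c
  have hi0 : Integrable (fun x => β * u x) AddCircle.haarAddCircle :=
    (hu.integrable (by norm_num)).const_mul β
  have h1 : (fun x => (α * fourier 1 x + β + γ * (fourier 1 x)⁻¹) * u x) =
      (fun x => α * ((fourier 1 x : ℂ) * u x)) + (fun x => β * u x) +
        (fun x => γ * ((fourier (-1) x : ℂ) * u x)) := by
    funext x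
    simp only [Pi.add_apply]
    rw [fourier_neg, ← Complex.inv_eq_conj (norm_fourier_apply 1 x)]
    ring
  rw [h1, fourierCoeff.add ((hi 1 α).add hi0) (hi (-1) γ), fourierCoeff.add (hi 1 α) hi0]
  simp only [Pi.add_apply]
  rw [fourierCoeff.const_mul, fourierCoeff.const_mul, fourierCoeff.const_mul,
    fourierCoeff_fourier_mul, fourierCoeff_fourier_mul, sub_neg_eq_add]

/-- Duality: a square-summable eigenvector of the walk vanishes. -/
theorem eq_zero_of_walk {t l l' c κ s Φ : ℝ} {z τ : ℂ} (hl : l ≠ 0) (hc0 : c ≠ 0)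
    (hκ : κ * (1 + t ^ 2) = 1) (hL : l ^ 2 + l' ^ 2 = 1)
    (hc : c ^ 2 - (1 - t ^ 2) * l' * c + t ^ 2 * l ^ 2 = 0) (hsc : s * c = -(t * l))
    (hs : |s| < 1) (hΦ : Irrational Φ) (hz : ‖z‖ = 1) (hτ : ‖τ‖ = 1)
    (hτΦ : ∀ n : ℤ, (fourier n (Φ : UnitAddCircle) : ℂ) ≠ τ ^ 2) {p q U φ χ : ℤ → ℂ}
    (hU : ∀ n, U n = τ * fourier n (Φ : UnitAddCircle))
    (hp : Summable fun n => ‖p n‖ ^ 2) (hq : Summable fun n => ‖q n‖ ^ 2)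
    (hφ : ∀ n, φ n = dualF κ l l' t (U n) * p n - dualGConj κ l l' t (U n) * q n)
    (hχ : ∀ n, χ n = dualG κ l l' t (U n) * p n + dualF κ l l' t (U n) * q n)
    (h1 : ∀ n, z * p n = l * φ (n - 1) - l' * χ n)
    (h2 : ∀ n, z * q n = l * χ (n + 1) + l' * φ n) (n : ℤ) : p n = 0 ∧ q n = 0 := by
  have hz0 : z ≠ 0 := norm_ne_zero_iff.1 (by rw [hz]; exact one_ne_zero)
  have hzz : z * z⁻¹ = 1 := mul_inv_cancel₀ hz0
  have hτ0 : τ ≠ 0 := norm_ne_zero_iff.1 (by rw [hτ]; exact one_ne_zero)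
  have hττ : τ * τ⁻¹ = 1 := mul_inv_cancel₀ hτ0
  have hL' : (l : ℂ) ^ 2 + l' ^ 2 = 1 := by exact_mod_cast hL
  have hζ0 : ∀ x : UnitAddCircle, (fourier 1 x : ℂ) ≠ 0 := fun x =>
    norm_ne_zero_iff.1 (by rw [norm_fourier_apply]; exact one_ne_zero)
  let y : UnitAddCircle := (Φ : UnitAddCircle)
  have hsum2 : ∀ (α β : ℂ), Summable fun n => ‖α * p n + β * q n‖ ^ 2 := by
    intro α β
    refine ((hp.mul_left (2 * ‖α‖ ^ 2)).add (hq.mul_left (2 * ‖β‖ ^ 2))).of_nonneg_of_le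
      (fun _ => by positivity) fun n => ?_
    have := norm_add_le (α * p n) (β * q n)
    rw [norm_mul, norm_mul] at this
    calc ‖α * p n + β * q n‖ ^ 2 ≤ (‖α‖ * ‖p n‖ + ‖β‖ * ‖q n‖) ^ 2 := by gcongr
      _ ≤ _ := by nlinarith [sq_nonneg (‖α‖ * ‖p n‖ - ‖β‖ * ‖q n‖)]
  obtain ⟨a, ha, hac⟩ := exists_memLp_fourierCoeff_eq (hsum2 (-1) (-t))
  obtain ⟨h, hh, hhc⟩ := exists_memLp_fourierCoeff_eq (hsum2 t (-1))
  have htr : ∀ {u : UnitAddCircle → ℂ} (r : UnitAddCircle), MemLp u 2 AddCircle.haarAddCircle →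
      MemLp (fun x => u (x + r)) 2 AddCircle.haarAddCircle := fun r hu =>
    hu.comp_measurePreserving (measurePreserving_add_right AddCircle.haarAddCircle r)
  let S : UnitAddCircle → ℂ := fun x => l * τ * a (x + y) + (-l') * h x
  let b : UnitAddCircle → ℂ := fun x => l' * a x + l * τ⁻¹ * h (x + -y)
  have hcomb : ∀ {u v : UnitAddCircle → ℂ} (α β : ℂ), MemLp u 2 AddCircle.haarAddCircle →
      MemLp v 2 AddCircle.haarAddCircle →
      MemLp (fun x => α * u x + β * v x) 2 AddCircle.haarAddCircle ∧
      ∀ n, fourierCoeff (fun x => α * u x + β * v x) n =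
        α * fourierCoeff u n + β * fourierCoeff v n := by
    intro u v α β hu hv
    refine ⟨(hu.const_mul α).add (hv.const_mul β), fun n => ?_⟩
    have := congrFun (fourierCoeff.add ((hu.const_mul α).integrable (by norm_num))
      ((hv.const_mul β).integrable (by norm_num))) n
    rw [Pi.add_apply, fourierCoeff.const_mul, fourierCoeff.const_mul] at this
    exact this
  obtain ⟨hS, hSc⟩ := hcomb (l * τ) (-l') (htr y ha) hh
  obtain ⟨hb, hbc⟩ := hcomb l' (l * τ⁻¹) ha (htr (-y) hh)
  have hUinv : ∀ n, (U n)⁻¹ = τ⁻¹ * fourier n (-y) := by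
    intro n
    rw [hU, mul_inv, Complex.inv_eq_conj (norm_fourier_apply n _), ← fourier_neg]
    simp [y, fourier_apply]
  have hSc' : ∀ n, fourierCoeff S n =
      l * U n * (-1 * p n + -t * q n) - l' * (t * p n + -1 * q n) := by
    intro n
    rw [hSc, fourierCoeff_comp_add_right, hac, hhc, hU]
    ring
  have hbc' : ∀ n, fourierCoeff b n =
      l' * (-1 * p n + -t * q n) + l * (U n)⁻¹ * (t * p n + -1 * q n) := by
    intro n
    rw [hbc, fourierCoeff_comp_add_right, hac, hhc, hUinv]
    ring
  have hφS : ∀ n, φ n = κ * (t * fourierCoeff S n - fourierCoeff b n) := by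
    intro n
    rw [hφ, hSc', hbc', dualF, dualGConj]
    ring
  have hχS : ∀ n, χ n = κ * (fourierCoeff S n + t * fourierCoeff b n) := by
    intro n
    rw [hχ, hSc', hbc', dualF, dualG]
    ring
  have hcont : Continuous fun x : UnitAddCircle => (fourier 1 x : ℂ) := (fourier 1).continuous
  have hFL : ∀ ζ : ℂ, dualF κ l l' t ζ = (-κ * t * l) * ζ + κ * (1 - t ^ 2) * l' +
      (-κ * t * l) * ζ⁻¹ := fun ζ => by rw [dualF]; ring
  have hGL : ∀ ζ : ℂ, dualG κ l l' t ζ = (-κ * l) * ζ + (-2 * κ * t * l') +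
      (κ * t ^ 2 * l) * ζ⁻¹ := fun ζ => by rw [dualG]; ring
  have hGcL : ∀ ζ : ℂ, dualGConj κ l l' t ζ = (κ * t ^ 2 * l) * ζ + (-2 * κ * t * l') +
      (-κ * l) * ζ⁻¹ := fun ζ => by rw [dualGConj]; ring
  have hlaur : ∀ α β γ : ℂ, Continuous fun x : UnitAddCircle =>
      α * (fourier 1 x : ℂ) + β + γ * (fourier 1 x : ℂ)⁻¹ := fun α β γ => by
    fun_prop (disch := exact hζ0)
  have hEa : ∀ᵐ x ∂(AddCircle.haarAddCircle (T := 1)), z * a x =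
      1 * (dualF κ l l' t (fourier 1 x) * S x) + -1 * (dualG κ l l' t (fourier 1 x) * b x) := by
    simp only [hFL, hGL]
    obtain ⟨hm, hcf⟩ := hcomb 1 (-1) (memLp_continuous_mul (hlaur _ _ _) hS)
      (memLp_continuous_mul (hlaur _ _ _) hb)
    refine ae_eq_of_fourierCoeff_eq (ha.const_mul z) hm fun n => ?_
    rw [hcf, fourierCoeff_laurent_mul hS, fourierCoeff_laurent_mul hb, fourierCoeff.const_mul, hac]
    have e1 := h1 n
    have e2 := h2 n
    rw [hφS, hχS] at e1 e2
    linear_combination -e1 - t * e2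
  have hEh : ∀ᵐ x ∂(AddCircle.haarAddCircle (T := 1)), z * h x =
      1 * (dualGConj κ l l' t (fourier 1 x) * S x) +
        1 * (dualF κ l l' t (fourier 1 x) * b x) := by
    simp only [hFL, hGcL]
    obtain ⟨hm, hcf⟩ := hcomb 1 1 (memLp_continuous_mul (hlaur _ _ _) hS)
      (memLp_continuous_mul (hlaur _ _ _) hb)
    refine ae_eq_of_fourierCoeff_eq (hh.const_mul z) hm fun n => ?_
    rw [hcf, fourierCoeff_laurent_mul hS, fourierCoeff_laurent_mul hb, fourierCoeff.const_mul, hhc]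
    have e1 := h1 n
    have e2 := h2 n
    rw [hφS, hχS] at e1 e2
    linear_combination t * e1 - e2
  obtain ⟨ha0, hb0⟩ := ae_eq_zero_of_dual_cocycle hl hc0 hκ hL hc hsc hs hΦ hz hτ hτΦ ha hb (by
    filter_upwards [hEa, hEh] with x ea eh
    have hsum := dualF_sq_add hκ hL (hζ0 x)
    have e1 : dualF κ l l' t (fourier 1 x) * S x =
        z * a x + dualG κ l l' t (fourier 1 x) * b x := by linear_combination -ea
    have e2 : dualF κ l l' t (fourier 1 x) * h x =
        dualGConj κ l l' t (fourier 1 x) * a x + z⁻¹ * b x := by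
      apply mul_left_cancel₀ hz0
      linear_combination dualF κ l l' t (fourier 1 x) * eh +
        dualGConj κ l l' t (fourier 1 x) * e1 + b x * hsum - b x * hzz
    have e3 : b (x + y) = l' * a (x + y) + l * τ⁻¹ * h x := by
      simp only [b, add_neg_cancel_right]
    have e4 : S x = l * τ * a (x + y) + (-l') * h x := rfl
    ext
    · simp only [Prod.smul_fst, smul_eq_mul, dualStep]
      linear_combination e1 + l' * e2 - dualF κ l l' t (fourier 1 x) * e4
    · simp only [Prod.smul_snd, smul_eq_mul, dualStep]
      linear_combination l' * e1 + e2 - l' * dualF κ l l' t (fourier 1 x) * e4 +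
        l * dualF κ l l' t (fourier 1 x) * τ * e3 +
        (l ^ 2 * dualF κ l l' t (fourier 1 x) * h x) * hττ +
        dualF κ l l' t (fourier 1 x) * h x * hL')
  have hzero : ∀ n, fourierCoeff (0 : UnitAddCircle → ℂ) n = 0 := fun n => by simp [fourierCoeff]
  have k1 : -1 * p n + -t * q n = 0 := by
    rw [← hac, fourierCoeff_congr_ae ha0, hzero]
  have k2 : l * (U n)⁻¹ * (t * p n + -1 * q n) = 0 := by
    have := hbc' n
    rw [fourierCoeff_congr_ae hb0, hzero, k1, mul_zero, zero_add] at this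
    exact this.symm
  have hUn : U n ≠ 0 := by
    rw [hU]
    exact mul_ne_zero hτ0 (norm_ne_zero_iff.1 (by rw [norm_fourier_apply]; exact one_ne_zero))
  have k3 : t * p n + -1 * q n = 0 := (mul_eq_zero.1 k2).resolve_left
    (mul_ne_zero (by exact_mod_cast hl) (inv_ne_zero hUn))
  have hκ' : (κ : ℂ) * (1 + t ^ 2) = 1 := by exact_mod_cast hκ
  constructor
  · linear_combination -κ * k1 + κ * t * k3 - p n * hκ'
  · linear_combination -κ * t * k1 - κ * k3 - q n * hκ'

/-- In the critical region the diagonal entry of the dual coin factors with a root inside the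
unit disc. -/
theorem exists_root_of_lt {t l l' : ℝ} (ht : t ^ 2 < 1) (hl : 0 < l) (hl' : 0 ≤ l')
    (hL : l ^ 2 + l' ^ 2 = 1) (h : l * (1 + t ^ 2) < 1 - t ^ 2) :
    ∃ c s : ℝ, c ≠ 0 ∧ c ^ 2 - (1 - t ^ 2) * l' * c + t ^ 2 * l ^ 2 = 0 ∧ s * c = -(t * l) ∧
      |s| < 1 := by
  have hD : 0 < ((1 - t ^ 2) * l') ^ 2 - 4 * (t ^ 2 * l ^ 2) := by
    have h1 : (l * (1 + t ^ 2)) ^ 2 < (1 - t ^ 2) ^ 2 := by gcongr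
    nlinarith
  have hr := Real.sq_sqrt hD.le
  have hr0 := Real.sqrt_pos.2 hD
  set r := Real.sqrt (((1 - t ^ 2) * l') ^ 2 - 4 * (t ^ 2 * l ^ 2))
  have hA : 0 ≤ (1 - t ^ 2) * l' := mul_nonneg (by linarith) hl'
  have hc : 0 < ((1 - t ^ 2) * l' + r) / 2 := by positivity
  refine ⟨((1 - t ^ 2) * l' + r) / 2, -(t * l) / (((1 - t ^ 2) * l' + r) / 2), hc.ne', ?_,
    div_mul_cancel₀ _ hc.ne', ?_⟩
  · linear_combination (1 / 4 : ℝ) * hr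
  · rw [abs_div, abs_neg, abs_of_pos hc, div_lt_one hc]
    refine abs_lt_of_sq_lt_sq ?_ hc.le
    nlinarith

theorem fourier_ne_of_forall_ne {θ Φ : ℝ} (hθ : ∀ j m : ℤ, 2 * θ + (j : ℝ) * Φ ≠ (m : ℝ)) (n : ℤ) :
    (fourier n (Φ : UnitAddCircle) : ℂ) ≠ fourier 1 (θ : UnitAddCircle) ^ 2 := by
  intro h
  rw [fourier_coe_apply, fourier_coe_apply, ← Complex.exp_nat_mul,
    Complex.exp_eq_exp_iff_exists_int] at h
  obtain ⟨m, hm⟩ := h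
  refine hθ (-n) (-m) ?_
  have h2 : (2 * Real.pi * Complex.I : ℂ) ≠ 0 := Complex.two_pi_I_ne_zero
  have h3 : (2 * θ + ((-n : ℤ) : ℝ) * Φ : ℂ) = ((-m : ℤ) : ℝ) := by
    apply mul_left_cancel₀ h2
    push_cast at hm ⊢
    simp only [div_one, mul_one] at hm
    linear_combination -hm
  exact_mod_cast h3

theorem fourier_one_add_int_mul (θ Φ : ℝ) (n : ℤ) :
    (fourier 1 ((θ + n * Φ : ℝ) : UnitAddCircle) : ℂ) =
      fourier 1 (θ : UnitAddCircle) * fourier n (Φ : UnitAddCircle) := by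
  rw [AddCircle.coe_add, fourier_add_apply]
  congr 1
  rw [← zsmul_eq_mul, AddCircle.coe_zsmul, fourier_one, fourier_apply]

/-- Absence of eigenvalues in the critical (self-dual) region: for
`λ₁ = λ₂ ∈ (0, (1−t²)/(1+t²))`, `Φ` irrational and `θ` Φ-irrational, the walk operator
`W_{λ₁,λ₁,Φ,θ}` has no ℓ² eigenvectors. -/
theorem no_eigenvalues_critical_region
    (t l1 Φ θ : ℝ)
    (ht : t ∈ Set.Ioo (-1 : ℝ) 1)
    (hl1 : l1 ∈ Set.Ioo (0 : ℝ) ((1 - t ^ 2) / (1 + t ^ 2)))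
    (hΦ : Irrational Φ)
    (hθ : ∀ j m : ℤ, 2 * θ + (j : ℝ) * Φ ≠ (m : ℝ)) :
    ∀ (z : ℂ) (ψ : H2), IsEigen t l1 l1 Φ θ z (fun n => ψ n) → ψ = 0 := by
  intro z ψ hψ
  have ht2 : t ^ 2 < 1 := (sq_lt_one_iff_abs_lt_one t).2 (abs_lt.2 ht)
  have hl := hl1.1
  have hcrit : l1 * (1 + t ^ 2) < 1 - t ^ 2 := (lt_div_iff₀ (by positivity)).1 hl1.2
  have hl_lt : l1 < 1 := by nlinarith [sq_nonneg t]
  have hL : l1 ^ 2 + sq1 l1 ^ 2 = 1 := sq1_sq_add (by nlinarith)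
  obtain ⟨c, s, hc0, hc, hsc, hs⟩ := exists_root_of_lt ht2 hl (Real.sqrt_nonneg _) hL hcrit
  have hκ : 1 / (1 + t ^ 2) * (1 + t ^ 2) = 1 := one_div_mul_cancel (by positivity)
  set κ : ℝ := 1 / (1 + t ^ 2)
  have hsumm : Summable fun n => ‖ψ n‖ ^ 2 := by
    have := (lp.memℓp ψ).summable (by norm_num)
    simpa using this
  have hnorm : ∀ n, ‖ψ n‖ ^ 2 = ‖ψ n 0‖ ^ 2 + ‖ψ n 1‖ ^ 2 := fun n => by
    rw [EuclideanSpace.norm_sq_eq, Fin.sum_univ_two]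
  have hp : Summable fun n => ‖ψ n 0‖ ^ 2 := hsumm.of_nonneg_of_le (fun _ => by positivity)
    fun n => by rw [hnorm]; exact le_add_of_nonneg_right (by positivity)
  have hq : Summable fun n => ‖ψ n 1‖ ^ 2 := hsumm.of_nonneg_of_le (fun _ => by positivity)
    fun n => by rw [hnorm]; exact le_add_of_nonneg_left (by positivity)
  let U : ℤ → ℂ := fun n => fourier 1 ((θ + n * Φ : ℝ) : UnitAddCircle)
  have hU1 : ∀ n, ‖U n‖ = 1 := fun n => norm_fourier_apply 1 _
  have hU0 : ∀ n, U n ≠ 0 := fun n => norm_ne_zero_iff.1 (by rw [hU1]; exact one_ne_zero)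
  have hGc : ∀ n, (starRingEnd ℂ) (dualG κ l1 (sq1 l1) t (U n)) =
      dualGConj κ l1 (sq1 l1) t (U n) := fun n => dualG_conj (hU1 n)
  have hG : ∀ n, (starRingEnd ℂ) (dualGConj κ l1 (sq1 l1) t (U n)) =
      dualG κ l1 (sq1 l1) t (U n) := fun n => by rw [← hGc, Complex.conj_conj]
  have hf : ∀ n : ℤ, (fS t l1 (θ + n * Φ) : ℂ) = dualF κ l1 (sq1 l1) t (U n) :=
    fun n => fS_eq_dualF t l1 _
  have hg : ∀ n : ℤ, gS t l1 (θ + n * Φ) = dualGConj κ l1 (sq1 l1) t (U n) :=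
    fun n => gS_eq_dualGConj t l1 _
  let φ : ℤ → ℂ := fun n =>
    dualF κ l1 (sq1 l1) t (U n) * ψ n 0 - dualGConj κ l1 (sq1 l1) t (U n) * ψ n 1
  let χ : ℤ → ℂ := fun n =>
    dualG κ l1 (sq1 l1) t (U n) * ψ n 0 + dualF κ l1 (sq1 l1) t (U n) * ψ n 1
  have h1 : ∀ n, z * ψ n 0 = l1 * φ (n - 1) - sq1 l1 * χ n := by
    intro n
    have := (hψ n).1
    rw [wPlus, show (n : ℝ) - 1 = ((n - 1 : ℤ) : ℝ) by push_cast; ring, hf, hg, hf, hg, hG] at this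
    exact this.symm
  have h2 : ∀ n, z * ψ n 1 = l1 * χ (n + 1) + sq1 l1 * φ n := by
    intro n
    have := (hψ n).2
    rw [wMinus, show (n : ℝ) + 1 = ((n + 1 : ℤ) : ℝ) by push_cast; ring, hf, hg, hf, hg, hG] at this
    exact this.symm
  have hcoin : ∀ n, ‖φ n‖ ^ 2 + ‖χ n‖ ^ 2 = ‖ψ n 0‖ ^ 2 + ‖ψ n 1‖ ^ 2 := by
    intro n
    have hsum := dualF_sq_add hκ hL (hU0 n)
    have hF : (starRingEnd ℂ) (dualF κ l1 (sq1 l1) t (U n)) = dualF κ l1 (sq1 l1) t (U n) := by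
      rw [← hf, Complex.conj_ofReal]
    rw [← Complex.ofReal_inj]
    push_cast
    simp only [← Complex.mul_conj', φ, χ, map_add, map_sub, map_mul, hF, hG, hGc]
    linear_combination (ψ n 0 * (starRingEnd ℂ) (ψ n 0) + ψ n 1 * (starRingEnd ℂ) (ψ n 1)) * hsum
  have hzero : ∀ n, ψ n 0 = 0 ∧ ψ n 1 = 0 := by
    rcases norm_eq_one_of_walk hL hp hq hcoin h1 h2 with hz | h
    · exact eq_zero_of_walk hl.ne' hc0 hκ hL hc hsc hs hΦ hz
        (norm_fourier_apply 1 (θ : UnitAddCircle)) (fourier_ne_of_forall_ne hθ)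
        (fourier_one_add_int_mul θ Φ) hp hq (fun _ => rfl) (fun _ => rfl) h1 h2
    · exact h
  refine lp.ext (funext fun n => ?_)
  ext i
  fin_cases i
  · exact (hzero n).1
  · exact (hzero n).2

end
end
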